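/- Let n ≥ 1, let μ ∈ ℤⁿ be dominant with μ₁ ≥ … ≥ μₙ ≥ 0, let n ≥ b ≥ a ≥ ℓ(μ), let E ∈ B(ϖ_a) and F ∈ B(ϖ_b) with E ⊗ T⁰_μ semistandard, and let j ∈ [n−1] with j ∉ E and j+1 ∈ E. Then Ψ_{F⊗E⊗T⁰_μ} = tT_j⁻¹ Ψ_{s_jF⊗s_jE⊗T⁰_μ} if s_jF ≤ F, and Ψ_{F⊗E⊗T⁰_μ} = T_j Ψ_{s_jF⊗s_jE⊗T⁰_μ} + (1−t) Ψ_{F⊗s_jE⊗T⁰_μ} if s_jF ≥ F. Moreover, for arbitrary columns E ∈ B(ϖ_a), F ∈ B(ϖ_b) with s_jE ≤ E: Ψ_{F⊗E} = tT_j⁻¹ Ψ_{s_jF⊗s_jE} if s_jF ≤ F, and Ψ_{F⊗E} = T_j Ψ_{s_jF⊗s_jE} + (1−t) Ψ_{F⊗s_jE} if s_jF ≥ F. -/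

import Mathlib

set_option maxHeartbeats 1000000

attribute [local instance] Classical.propDecidable

noncomputable section

namespace HLHecke

/-- The base ring `ℤ[t^{±1}]` of Laurent polynomials. -/
abbrev HR : Type := LaurentPolynomial ℤ

/-- The parameter `t`. -/
def tt : HR := LaurentPolynomial.T 1

/-! ### The symmetric group on `Fin n` -/

/-- The simple transposition `s_j = (j, j+1)` (junk value `1` if out of range). -/
def sgen (n : ℕ) (j : ℕ) : Equiv.Perm (Fin n) :=
  if h : j + 1 < n then Equiv.swap ⟨j, Nat.lt_of_succ_lt h⟩ ⟨j + 1, h⟩ else 1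

/-- The product `s_{i₁} ⋯ s_{i_ℓ}` of a word `l = [i₁, …, i_ℓ]`. -/
def wordProd (n : ℕ) (l : List ℕ) : Equiv.Perm (Fin n) := (l.map (sgen n)).prod

/-- The action of `S_n` on `ℤⁿ` by permutation of coordinates. -/
def wAct (n : ℕ) (w : Equiv.Perm (Fin n)) (μ : Fin n → ℤ) : Fin n → ℤ := fun i => μ (w⁻¹ i)

/-- The standard inner product on `ℤⁿ`. -/
def ip (n : ℕ) (μ ν : Fin n → ℤ) : ℤ := ∑ i, μ i * ν i

/-- The standard basis vector `ε_i`. -/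
def eps (n : ℕ) (i : Fin n) : Fin n → ℤ := fun k => if k = i then 1 else 0

/-- The simple root `α_j = ε_j − ε_{j+1}` (0-indexed: entries `j` and `j+1` of `Fin n`). -/
def alpha (n : ℕ) (j : ℕ) : Fin n → ℤ :=
  fun i => if (i : ℕ) = j then 1 else if (i : ℕ) = j + 1 then -1 else 0

/-- The fundamental weight `ϖ_k = ε₁ + … + ε_k`. -/
def varpi (n : ℕ) (k : ℕ) : Fin n → ℤ := fun i => if (i : ℕ) < k then 1 else 0

/-- The set of positive roots `R₊`. -/
def Rpos (n : ℕ) (β : Fin n → ℤ) : Prop := ∃ i j : Fin n, i < j ∧ β = eps n i - eps n j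

/-- The Coxeter length: minimal length of a word in the simple transpositions. -/
def len (n : ℕ) (w : Equiv.Perm (Fin n)) : ℕ :=
  sInf {k | ∃ l : List ℕ, (∀ j ∈ l, j + 1 < n) ∧ l.length = k ∧ wordProd n l = w}

/-- A choice of reduced word for `w`. -/
def redWord (n : ℕ) (w : Equiv.Perm (Fin n)) : List ℕ :=
  if h : ∃ l : List ℕ, (∀ j ∈ l, j + 1 < n) ∧ l.length = len n w ∧ wordProd n l = w
  then h.choose else []

/-! ### Columns -/

lemma col_card_le (n : ℕ) (C : Finset (Fin n)) : C.card ≤ n := by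
  simpa using Finset.card_le_univ C

/-- The minimal length coset representative `u_C` attached to a column `C`:
it sends `1, …, ℓ` to the entries of `C` in increasing order and `ℓ+1, …, n` to the
entries of the complement of `C` in increasing order. -/
def colPerm (n : ℕ) (C : Finset (Fin n)) : Equiv.Perm (Fin n) :=
  ((finCongr ((Nat.add_sub_cancel' (col_card_le n C)).symm)).trans
    finSumFinEquiv.symm).trans <|
  ((Equiv.sumCongr (C.orderIsoOfFin rfl).toEquiv
      ((Cᶜ.orderIsoOfFin (by simp [Finset.card_compl])).toEquiv)).trans <|
    (Equiv.sumCongr (Equiv.refl _) (Equiv.subtypeEquivRight (fun x => Finset.mem_compl))).trans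
      (Equiv.sumCompl (fun x => x ∈ C)))

/-- The `k`-th smallest entry of a column (0-indexed, as a natural number; junk `0` if
out of range). -/
def nth (n : ℕ) (C : Finset (Fin n)) (k : ℕ) : ℕ := ((C.sort (· ≤ ·)).map Fin.val).getD k 0

/-- The action of the simple transposition `s_j` on columns. -/
def sCol (n : ℕ) (j : ℕ) (C : Finset (Fin n)) : Finset (Fin n) := C.image (sgen n j)

/-- Semistandardness of the two-column filling `F ⊗ E` (`F` the left column):
entrywise `f_i ≤ e_i`. -/
def pairSS (n : ℕ) (F E : Finset (Fin n)) : Prop := ∀ k < E.card, nth n F k ≤ nth n E k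

/-- A filling by columns (leftmost column first) is semistandard iff all adjacent pairs are. -/
def isSSYT (n : ℕ) (L : List (Finset (Fin n))) : Prop := L.Chain' (pairSS n)

/-- The set `B(ϖ_ℓ)` of columns of length `ℓ`. -/
def colFinset (n : ℕ) (ℓ : ℕ) : Finset (Finset (Fin n)) := Finset.univ.filter fun C => C.card = ℓ

/-- The highest weight column `(1, …, k)`. -/
def hwCol (n : ℕ) (k : ℕ) : Finset (Fin n) := Finset.univ.filter fun x => (x : ℕ) < k

/-- The vector `⃗C ∈ ℤⁿ` attached to a column `C`. -/
def vecOf (n : ℕ) (C : Finset (Fin n)) : Fin n → ℤ := fun i => if i ∈ C then 1 else 0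

/-- The sign `σ^j_C`: `-1` if `j ∈ C` and `j+1 ∉ C`, and `+1` otherwise. -/
def sigmaSign (n : ℕ) (j : ℕ) (C : Finset (Fin n)) : ℤ :=
  if h : j + 1 < n then
    (if (⟨j, Nat.lt_of_succ_lt h⟩ : Fin n) ∈ C ∧ (⟨j + 1, h⟩ : Fin n) ∉ C then -1 else 1)
  else 1

/-! ### Shapes and tableaux -/

/-- The length `λ'_{j+1}` of the `(j+1)`-st column (0-indexed `j`) of the Young diagram
of a partition `λ`. -/
def shapeColLen (n : ℕ) (μ : Fin n → ℤ) (j : ℕ) : ℕ :=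
  (Finset.univ.filter fun i : Fin n => (j : ℤ) < μ i).card

/-- The number of columns of the Young diagram of a dominant weight. -/
def numCols (n : ℕ) (μ : Fin n → ℤ) : ℕ := Finset.univ.sup fun i : Fin n => (μ i).toNat

/-- The highest weight tableau `T⁰_μ`: row `i` is filled with `i`, i.e. its columns are the
highest weight columns. -/
def hwTableau (n : ℕ) (μ : Fin n → ℤ) : List (Finset (Fin n)) :=
  List.ofFn fun j : Fin (numCols n μ) => hwCol n (shapeColLen n μ (j : ℕ))

/-- The content vector of a tableau: `(wtVec T) i` is the number of entries equal to `i`. -/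
def wtVec (n : ℕ) (L : List (Finset (Fin n))) : Fin n → ℤ :=
  fun i => ((L.filter fun C => i ∈ C).length : ℤ)

/-! ### Macdonald's ψ statistic -/

/-- Number of entries `≤ i` in the column at position `p` (0-indexed from the left). -/
def colCount (n : ℕ) (L : List (Finset (Fin n))) (i p : ℕ) : ℕ :=
  ((L.getD p ∅).filter fun x => (x : ℕ) < i).card

/-- The factor `ψ_{T_{≤ i+1}/T_{≤ i}}` of Macdonald's ψ. -/
def stripFactor (n : ℕ) (L : List (Finset (Fin n))) (i : ℕ) : HR :=
  ∏ p ∈ Finset.range L.length,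
    if colCount n L (i + 1) p = colCount n L i p ∧
        colCount n L (i + 1) (p + 1) = colCount n L i (p + 1) + 1 then
      1 - tt ^ (colCount n L i p - colCount n L i (p + 1))
    else 1

/-- Macdonald's `ψ_T = ∏_{i=1}^{n-1} ψ_{T_{≤ i+1}/T_{≤ i}}` for a semistandard tableau. -/
def macPsi (n : ℕ) (L : List (Finset (Fin n))) : HR := ∏ i ∈ Finset.Ico 1 n, stripFactor n L i

/-- Macdonald's tableau statistic, extended by `0` to non-semistandard fillings. -/
def psiT (n : ℕ) (L : List (Finset (Fin n))) : HR := if isSSYT n L then macPsi n L else 0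

/-! ### The affine Hecke algebra -/

/-- Generators of the affine Hecke algebra. -/
inductive AGen (n : ℕ) : Type
  | T : ℕ → AGen n
  | X : Fin n → AGen n
  | Xinv : Fin n → AGen n

/-- The free algebra on the generators. -/
abbrev FA (n : ℕ) := FreeAlgebra HR (AGen n)

def fT (n : ℕ) (j : ℕ) : FA n := FreeAlgebra.ι HR (AGen.T j)
def fX (n : ℕ) (i : Fin n) : FA n := FreeAlgebra.ι HR (AGen.X i)
def fXi (n : ℕ) (i : Fin n) : FA n := FreeAlgebra.ι HR (AGen.Xinv i)

/-- The defining relations of the type `GL_n` affine Hecke algebra. -/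
inductive ARel (n : ℕ) : FA n → FA n → Prop
  | junk (j : ℕ) (h : ¬ j + 1 < n) : ARel n (fT n j) 1
  | quad (j : ℕ) (h : j + 1 < n) :
      ARel n (fT n j * fT n j) ((tt - 1) • fT n j + algebraMap HR (FA n) tt)
  | braid (j : ℕ) (h : j + 2 < n) :
      ARel n (fT n j * fT n (j + 1) * fT n j) (fT n (j + 1) * fT n j * fT n (j + 1))
  | commT (j k : ℕ) (hjk : j + 1 < k) (hk : k + 1 < n) :
      ARel n (fT n j * fT n k) (fT n k * fT n j)
  | commX (i i' : Fin n) : ARel n (fX n i * fX n i') (fX n i' * fX n i)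
  | XinvL (i : Fin n) : ARel n (fX n i * fXi n i) 1
  | XinvR (i : Fin n) : ARel n (fXi n i * fX n i) 1
  | TXT (j : ℕ) (h : j + 1 < n) :
      ARel n (fT n j * fX n ⟨j, Nat.lt_of_succ_lt h⟩ * fT n j) (tt • fX n ⟨j + 1, h⟩)
  | TXcomm (j : ℕ) (h : j + 1 < n) (i : Fin n) (hi1 : (i : ℕ) ≠ j) (hi2 : (i : ℕ) ≠ j + 1) :
      ARel n (fT n j * fX n i) (fX n i * fT n j)

/-- The type `GL_n` affine Hecke algebra. -/
abbrev H (n : ℕ) := RingQuot (ARel n)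

/-- The generator `T_j` of the (affine) Hecke algebra. -/
def Tg (n : ℕ) (j : ℕ) : H n := RingQuot.mkAlgHom HR (ARel n) (fT n j)

/-- The generator `X_i`. -/
def Xg (n : ℕ) (i : Fin n) : H n := RingQuot.mkAlgHom HR (ARel n) (fX n i)

/-- The generator `X_i⁻¹`. -/
def Xig (n : ℕ) (i : Fin n) : H n := RingQuot.mkAlgHom HR (ARel n) (fXi n i)

/-- The scalar `t` inside `H`. -/
def tH (n : ℕ) : H n := algebraMap HR (H n) tt

/-- The scalar `t^k` inside `H`. -/
def tpow (n : ℕ) (k : ℕ) : H n := algebraMap HR (H n) (tt ^ k)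

/-- The monomial `X^μ` for `μ ∈ ℤⁿ`. -/
def Xmon (n : ℕ) (μ : Fin n → ℤ) : H n :=
  (List.ofFn fun i : Fin n =>
    if 0 ≤ μ i then Xg n i ^ (μ i).toNat else Xig n i ^ (-μ i).toNat).prod

/-- The product `T_{i₁} ⋯ T_{i_ℓ}` of a word. -/
def TofWord (n : ℕ) (l : List ℕ) : H n := (l.map (Tg n)).prod

/-- The element `T_w`, defined via a choice of reduced word for `w`. -/
def Tw (n : ℕ) (w : Equiv.Perm (Fin n)) : H n := TofWord n (redWord n w)

/-- The finite Hecke symmetrizer `1₀ = Σ_{w ∈ S_n} T_w`. -/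
def one0 (n : ℕ) : H n := ∑ w : Equiv.Perm (Fin n), Tw n w

/-- The stabilizer `S_{n,λ}` as a finset. -/
def stabFinset (n : ℕ) (lam : Fin n → ℤ) : Finset (Equiv.Perm (Fin n)) :=
  Finset.univ.filter fun w => wAct n w lam = lam

/-- The parabolic symmetrizer `1_λ = Σ_{w ∈ S_{n,λ}} T_w`. -/
def onePara (n : ℕ) (lam : Fin n → ℤ) : H n := ∑ w ∈ stabFinset n lam, Tw n w

/-- The Poincaré polynomial `W_λ(t) = Σ_{w ∈ S_{n,λ}} t^{ℓ(w)}`. -/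
def Wlam (n : ℕ) (lam : Fin n → ℤ) : HR := ∑ w ∈ stabFinset n lam, tt ^ len n w

/-- The parabolic subalgebra `H_{n,λ}`, as the span of `{T_w : w ∈ S_{n,λ}}`. -/
def HparaM (n : ℕ) (lam : Fin n → ℤ) : Submodule HR (H n) :=
  Submodule.span HR (Tw n '' {w | wAct n w lam = lam})

/-- The finite Hecke algebra `H_n`, the subalgebra generated by the `T_j`. -/
def Hfin (n : ℕ) : Subalgebra HR (H n) := Algebra.adjoin HR (Set.range (Tg n))

/-- The coefficient `h_{C, S}` of the parabolic decomposition
`h = Σ_{F ∈ B(ϖ_ℓ)} T_{u_F} h_F` (defined via choice; it is unique). -/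
def paraCoeff (n : ℕ) (ℓ : ℕ) (h : H n) (C : Finset (Fin n)) : H n :=
  if hex : ∃ g : Finset (Fin n) → H n,
      (∀ F : Finset (Fin n), F.card = ℓ → g F ∈ HparaM n (varpi n ℓ)) ∧
      h = ∑ F ∈ colFinset n ℓ, Tw n (colPerm n F) * g F
  then hex.choose C else 0

/-- The elements `Ψ_T` of the finite Hecke algebra, defined by recursion on the columns of `T`
(leftmost column first).  By convention `Ψ` of the empty tableau is `1₀`. -/
def Psi (n : ℕ) : List (Finset (Fin n)) → H n
  | [] => one0 n
  | [C] => tpow n (len n (colPerm n C)) * Ring.inverse (Tw n (colPerm n C)⁻¹) *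
      onePara n (varpi n C.card)
  | C :: S => tpow n (len n (colPerm n C)) * Ring.inverse (Tw n (colPerm n C)⁻¹) *
      paraCoeff n C.card (Psi n S) C

end HLHecke

namespace HLHecke

/-! ### permutation combinatorics -/

def pos (n : ℕ) (w : Equiv.Perm (Fin n)) (i : ℕ) : ℕ :=
  if h : i < n then ((w⁻¹ ⟨i, h⟩ : Fin n) : ℕ) else 0

lemma sgen_val (n j : ℕ) (hj : j + 1 < n) (x : Fin n) :
    ((sgen n j x : Fin n) : ℕ) =
      if (x : ℕ) = j then j + 1 else if (x : ℕ) = j + 1 then j else x := by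
  unfold sgen
  rw [dif_pos hj, Equiv.swap_apply_def]
  simp only [Fin.ext_iff]
  split_ifs <;> simp

lemma sgen_mul_self (n j : ℕ) : sgen n j * sgen n j = 1 := by
  unfold sgen
  split_ifs <;> simp

lemma sgen_inv (n j : ℕ) : (sgen n j)⁻¹ = sgen n j :=
  inv_eq_of_mul_eq_one_left (sgen_mul_self n j)

lemma sgen_cancel (n j : ℕ) (w : Equiv.Perm (Fin n)) : sgen n j * (sgen n j * w) = w := by
  rw [← mul_assoc, sgen_mul_self, one_mul]

lemma sgen_far (n i j : ℕ) (hij : i + 1 < j) (hj : j + 1 < n) :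
    sgen n i * sgen n j = sgen n j * sgen n i := by
  ext x
  simp only [Equiv.Perm.mul_apply, sgen_val n i (by omega), sgen_val n j hj]
  split_ifs <;> omega

lemma sgen_braid (n i : ℕ) (hi : i + 2 < n) :
    sgen n i * sgen n (i + 1) * sgen n i = sgen n (i + 1) * sgen n i * sgen n (i + 1) := by
  ext x
  simp only [Equiv.Perm.mul_apply, sgen_val n i (by omega), sgen_val n (i + 1) hi]
  split_ifs <;> omega

lemma pos_s (n j : ℕ) (hj : j + 1 < n) (w : Equiv.Perm (Fin n)) (i : ℕ) :
    pos n (sgen n j * w) i =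
      if i = j then pos n w (j + 1) else if i = j + 1 then pos n w j else pos n w i := by
  unfold pos
  by_cases hi : i < n
  · have h1 : ((sgen n j * w)⁻¹ ⟨i, hi⟩ : Fin n) = w⁻¹ (sgen n j ⟨i, hi⟩) := by
      rw [mul_inv_rev, sgen_inv]; rfl
    have h2 := sgen_val n j hj ⟨i, hi⟩
    rw [dif_pos hi, h1]
    generalize sgen n j ⟨i, hi⟩ = y at h2
    obtain ⟨y, hy⟩ := y
    simp only at h2
    rw [dif_pos (show j < n by omega), dif_pos hj]
    split_ifs at h2 ⊢ <;> subst h2 <;> rfl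
  · rw [dif_neg hi]
    split_ifs <;> first | rfl | omega

lemma pos_lt (n : ℕ) (w : Equiv.Perm (Fin n)) (i : ℕ) (hi : i < n) : pos n w i < n := by
  unfold pos
  rw [dif_pos hi]
  exact Fin.isLt _

lemma pos_ne (n : ℕ) (w : Equiv.Perm (Fin n)) (i j : ℕ) (hi : i < n) (hj : j < n) (h : i ≠ j) :
    pos n w i ≠ pos n w j := by
  unfold pos
  rw [dif_pos hi, dif_pos hj]
  intro h'
  have := w⁻¹.injective (Fin.ext h')
  simp at this
  exact h this

lemma pos_ext_one (n : ℕ) (w : Equiv.Perm (Fin n))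
    (h : ∀ j, j + 1 < n → pos n w j < pos n w (j + 1)) : w = 1 := by
  have key : ∀ k i, i + k < n → pos n w i + k ≤ pos n w (i + k) := by
    intro k
    induction k with
    | zero => intro i _; simp
    | succ k ih =>
      intro i hi
      have h1 := ih i (by omega)
      have h2 := h (i + k) (by omega)
      have : i + (k + 1) = i + k + 1 := by ring
      rw [this]
      omega
  have : w⁻¹ = 1 := by
    ext x
    have hx := x.isLt
    have h1 := key x 0 (by omega)
    have h2 := key (n - 1 - x) x (by omega)
    have h3 := pos_lt n w (x + (n - 1 - x)) (by omega)
    rw [zero_add] at h1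
    have h4 : pos n w x = (w⁻¹ x : Fin n) := by
      unfold pos; rw [dif_pos hx]
    rw [← h4]
    simp only [Equiv.Perm.one_apply]
    omega
  simpa using this

def invSet (n : ℕ) (w : Equiv.Perm (Fin n)) : Finset (Fin n × Fin n) :=
  Finset.univ.filter fun p => p.1 < p.2 ∧ w p.2 < w p.1

def inv (n : ℕ) (w : Equiv.Perm (Fin n)) : ℕ := (invSet n w).card

lemma inv_asc (n j : ℕ) (hj : j + 1 < n) (w : Equiv.Perm (Fin n))
    (h : pos n w j < pos n w (j + 1)) : inv n (sgen n j * w) = inv n w + 1 := by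
  unfold pos at h
  rw [dif_pos (by omega), dif_pos hj] at h
  have hset : invSet n (sgen n j * w) =
      insert (w⁻¹ ⟨j, Nat.lt_of_succ_lt hj⟩, w⁻¹ ⟨j + 1, hj⟩) (invSet n w) := by
    ext ⟨a, b⟩
    simp only [invSet, Finset.mem_filter, Finset.mem_univ, true_and, Finset.mem_insert,
      Prod.mk.injEq, Equiv.Perm.mul_apply, Fin.lt_def, sgen_val n j hj]
    have ha : a = w⁻¹ ⟨j, Nat.lt_of_succ_lt hj⟩ ↔ (w a : ℕ) = j := by
      rw [Equiv.Perm.eq_inv_iff_eq, Fin.ext_iff]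
    have hb : b = w⁻¹ ⟨j + 1, by omega⟩ ↔ (w b : ℕ) = j + 1 := by
      rw [Equiv.Perm.eq_inv_iff_eq, Fin.ext_iff]
    by_cases hab : a < b
    · have hne : (w a : ℕ) ≠ w b := by
        intro h'
        exact hab.ne (w.injective (Fin.ext h'))
      rw [ha, hb]
      have : (a : ℕ) < b := hab
      simp only [this, true_and]
      have hx : ¬ ((w a : ℕ) = j + 1 ∧ (w b : ℕ) = j) := by
        rintro ⟨h1, h2⟩
        have ha' : a = w⁻¹ ⟨j + 1, hj⟩ := by
          rw [Equiv.Perm.eq_inv_iff_eq, Fin.ext_iff]; exact h1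
        have hb' : b = w⁻¹ ⟨j, Nat.lt_of_succ_lt hj⟩ := by
          rw [Equiv.Perm.eq_inv_iff_eq, Fin.ext_iff]; exact h2
        rw [← ha', ← hb'] at h
        omega
      clear ha hb h this
      generalize ((w a : Fin n) : ℕ) = x at *
      generalize ((w b : Fin n) : ℕ) = y at *
      split_ifs <;> omega
    · have h0 : ¬ ((a : ℕ) < b) := hab
      simp only [h0, false_and, or_false, false_iff, not_and]
      intro h1 h2
      subst h1 h2
      exact h0 h
  unfold inv
  rw [hset, Finset.card_insert_of_notMem]
  simp [invSet]

lemma inv_desc (n j : ℕ) (hj : j + 1 < n) (w : Equiv.Perm (Fin n))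
    (h : ¬ pos n w j < pos n w (j + 1)) : inv n (sgen n j * w) + 1 = inv n w := by
  have h1 := inv_asc n j hj (sgen n j * w) (by
    have := pos_ne n w j (j + 1) (by omega) hj (by omega)
    rw [pos_s n j hj, pos_s n j hj]
    simp
    omega)
  rw [sgen_cancel] at h1
  omega

lemma inv_one (n : ℕ) : inv n 1 = 0 := by
  unfold inv invSet
  rw [Finset.card_eq_zero, Finset.filter_eq_empty_iff]
  rintro ⟨a, b⟩ _ ⟨h1, h2⟩
  exact absurd h1 (not_lt.mpr (le_of_lt h2))

lemma inv_inv' (n : ℕ) (w : Equiv.Perm (Fin n)) : inv n w⁻¹ = inv n w := by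
  unfold inv invSet
  apply Finset.card_bij' (fun p _ => (w⁻¹ p.2, w⁻¹ p.1)) (fun p _ => (w p.2, w p.1))
  all_goals simp
  all_goals exact fun a b h1 h2 => ⟨h2, h1⟩

def valid (n : ℕ) (l : List ℕ) : Prop := ∀ j ∈ l, j + 1 < n

lemma wordProd_cons (n i : ℕ) (l : List ℕ) :
    wordProd n (i :: l) = sgen n i * wordProd n l := by simp [wordProd]

lemma wordProd_append (n : ℕ) (l l' : List ℕ) :
    wordProd n (l ++ l') = wordProd n l * wordProd n l' := by simp [wordProd]

lemma inv_word (n : ℕ) (l : List ℕ) (hl : valid n l) : inv n (wordProd n l) ≤ l.length := by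
  induction l with
  | nil => simp [wordProd, inv_one]
  | cons i l ih =>
    rw [wordProd_cons]
    have h1 := ih (fun j hj => hl j (by simp [hj]))
    have hi := hl i (by simp)
    by_cases h : pos n (wordProd n l) i < pos n (wordProd n l) (i + 1)
    · rw [inv_asc n i hi _ h]; simpa
    · have := inv_desc n i hi _ h
      simp; omega

lemma exists_desc (n : ℕ) (w : Equiv.Perm (Fin n)) (h : w ≠ 1) :
    ∃ j, j + 1 < n ∧ ¬ pos n w j < pos n w (j + 1) := by
  by_contra! h'
  exact h (pos_ext_one n w h')

lemma exists_word (n : ℕ) (w : Equiv.Perm (Fin n)) :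
    ∃ l, valid n l ∧ l.length = inv n w ∧ wordProd n l = w := by
  induction hk : inv n w generalizing w with
  | zero =>
    refine ⟨[], by simp [valid], by simp, ?_⟩
    by_contra h
    obtain ⟨j, hj, hd⟩ := exists_desc n w (by simpa [wordProd, eq_comm] using h)
    have := inv_desc n j hj w hd
    omega
  | succ k ih =>
    have h : w ≠ 1 := by
      rintro rfl
      rw [inv_one] at hk; omega
    obtain ⟨j, hj, hd⟩ := exists_desc n w h
    have := inv_desc n j hj w hd
    obtain ⟨l, h1, h2, h3⟩ := ih (sgen n j * w) (by omega)
    refine ⟨j :: l, ?_, by simp [h2], ?_⟩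
    · intro i hi
      rcases List.mem_cons.mp hi with rfl | hi
      · exact hj
      · exact h1 i hi
    · rw [wordProd_cons, h3, sgen_cancel]

lemma len_eq (n : ℕ) (w : Equiv.Perm (Fin n)) : len n w = inv n w := by
  apply le_antisymm
  · apply Nat.sInf_le
    obtain ⟨l, h1, h2, h3⟩ := exists_word n w
    exact ⟨l, h1, h2, h3⟩
  · apply le_csInf
    · obtain ⟨l, h1, h2, h3⟩ := exists_word n w
      exact ⟨_, l, h1, h2, h3⟩
    · rintro k ⟨l, h1, h2, h3⟩
      rw [← h2, ← h3]
      exact inv_word n l h1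

lemma redWord_spec (n : ℕ) (w : Equiv.Perm (Fin n)) :
    valid n (redWord n w) ∧ (redWord n w).length = inv n w ∧ wordProd n (redWord n w) = w := by
  have h : ∃ l : List ℕ, (∀ j ∈ l, j + 1 < n) ∧ l.length = len n w ∧ wordProd n l = w := by
    rw [len_eq]; exact exists_word n w
  unfold redWord
  rw [dif_pos h, ← len_eq]
  exact h.choose_spec

/-! ### Hecke relations -/

lemma Tg_junk (n j : ℕ) (h : ¬ j + 1 < n) : Tg n j = 1 := by
  unfold Tg
  rw [RingQuot.mkAlgHom_rel HR (ARel.junk j h), map_one]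

lemma Tg_quad (n j : ℕ) (h : j + 1 < n) : Tg n j * Tg n j = (tt - 1) • Tg n j + tt • 1 := by
  unfold Tg
  rw [← map_mul, RingQuot.mkAlgHom_rel HR (ARel.quad j h), map_add, map_smul, AlgHom.commutes,
    Algebra.algebraMap_eq_smul_one]

lemma Tg_braid (n j : ℕ) (h : j + 2 < n) :
    Tg n j * Tg n (j + 1) * Tg n j = Tg n (j + 1) * Tg n j * Tg n (j + 1) := by
  unfold Tg
  rw [← map_mul, ← map_mul, RingQuot.mkAlgHom_rel HR (ARel.braid j h), map_mul, map_mul]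

lemma Tg_comm (n j k : ℕ) (hjk : j + 1 < k) (hk : k + 1 < n) :
    Tg n j * Tg n k = Tg n k * Tg n j := by
  unfold Tg
  rw [← map_mul, RingQuot.mkAlgHom_rel HR (ARel.commT j k hjk hk), map_mul]

lemma TofWord_cons (n i : ℕ) (l : List ℕ) :
    TofWord n (i :: l) = Tg n i * TofWord n l := by simp [TofWord]

lemma valid_cons (n i : ℕ) (l : List ℕ) : valid n (i :: l) ↔ i + 1 < n ∧ valid n l := by
  simp [valid]

def MatsP (n k : ℕ) : Prop := ∀ l l', valid n l → valid n l' → l.length = k → l'.length = k →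
  wordProd n l = wordProd n l' → inv n (wordProd n l) = k → TofWord n l = TofWord n l'

lemma red_tail (n i k : ℕ) (m : List ℕ) (hi : i + 1 < n) (hm : valid n m) (hlen : m.length = k)
    (h : inv n (sgen n i * wordProd n m) = k + 1) :
    inv n (wordProd n m) = k ∧ pos n (wordProd n m) i < pos n (wordProd n m) (i + 1) := by
  have h1 := inv_word n m hm
  by_cases hd : pos n (wordProd n m) i < pos n (wordProd n m) (i + 1)
  · have := inv_asc n i hi _ hd
    exact ⟨by omega, hd⟩
  · have := inv_desc n i hi _ hd
    omega

lemma mats_step (n k : ℕ) (IH : MatsP n k) (i j : ℕ) (m m' : List ℕ) (hij : i < j)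
    (hi : i + 1 < n) (hj : j + 1 < n) (hm : valid n m) (hm' : valid n m')
    (hlm : m.length = k) (hlm' : m'.length = k)
    (he : sgen n i * wordProd n m = sgen n j * wordProd n m')
    (hinv : inv n (sgen n i * wordProd n m) = k + 1) :
    Tg n i * TofWord n m = Tg n j * TofWord n m' := by
  obtain ⟨a1, a2⟩ := red_tail n i k m hi hm hlm hinv
  obtain ⟨b1, b2⟩ := red_tail n j k m' hj hm' hlm' (he ▸ hinv)
  obtain ⟨w, hw⟩ : ∃ w, w = sgen n i * wordProd n m := ⟨_, rfl⟩
  rw [← hw] at he hinv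
  have e1 : wordProd n m = sgen n i * w := by rw [hw, sgen_cancel]
  have e2 : wordProd n m' = sgen n j * w := by rw [he, sgen_cancel]
  rw [e1] at a1 a2
  rw [e2] at b1 b2
  have a3 : pos n w (i + 1) < pos n w i := by
    rw [pos_s n i hi, pos_s n i hi] at a2
    simpa using a2
  have b3 : pos n w (j + 1) < pos n w j := by
    rw [pos_s n j hj, pos_s n j hj] at b2
    simpa using b2
  rcases Nat.lt_or_ge (i + 1) j with hf | hf
  · have d1 := inv_desc n j hj (sgen n i * w) (by
      simp only [pos_s n i hi]
      split_ifs <;> omega)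
    obtain ⟨m0, v0, l0, p0⟩ := exists_word n (sgen n j * (sgen n i * w))
    have c1 : TofWord n m = TofWord n (j :: m0) := by
      apply IH _ _ hm ((valid_cons _ _ _).2 ⟨hj, v0⟩) hlm (by simp; omega)
      · rw [wordProd_cons, p0, sgen_cancel, e1]
      · rw [e1]; exact a1
    have c2 : TofWord n m' = TofWord n (i :: m0) := by
      apply IH _ _ hm' ((valid_cons _ _ _).2 ⟨hi, v0⟩) hlm' (by simp; omega)
      · rw [wordProd_cons, p0, ← mul_assoc, sgen_far n i j hf hj, mul_assoc, sgen_cancel, e2]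
      · rw [e2]; exact b1
    rw [c1, c2, TofWord_cons, TofWord_cons, ← mul_assoc, ← mul_assoc, Tg_comm n i j hf hj]
  · obtain rfl : j = i + 1 := by omega
    have d1 := inv_desc n (i + 1) hj (sgen n i * w) (by
      simp only [pos_s n i hi]
      split_ifs <;> omega)
    have d2 := inv_desc n i hi (sgen n (i + 1) * (sgen n i * w)) (by
      simp only [pos_s n i hi, pos_s n (i + 1) hj]
      split_ifs <;> omega)
    obtain ⟨m0, v0, l0, p0⟩ := exists_word n (sgen n i * (sgen n (i + 1) * (sgen n i * w)))
    have c1 : TofWord n m = TofWord n ((i + 1) :: i :: m0) := by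
      apply IH _ _ hm (by simp [valid_cons, v0, hi, hj]) hlm (by simp; omega)
      · rw [wordProd_cons, wordProd_cons, p0, sgen_cancel, sgen_cancel, e1]
      · rw [e1]; exact a1
    have c2 : TofWord n m' = TofWord n (i :: (i + 1) :: m0) := by
      apply IH _ _ hm' (by simp [valid_cons, v0, hi, hj]) hlm' (by simp; omega)
      · rw [wordProd_cons, wordProd_cons, p0, e2]
        have := sgen_braid n i hj
        have h3 : sgen n i * (sgen n (i + 1) * (sgen n i * w)) =
            sgen n (i + 1) * (sgen n i * (sgen n (i + 1) * w)) := by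
          simpa only [mul_assoc] using congrArg (· * w) this
        rw [h3, sgen_cancel, sgen_cancel]
      · rw [e2]; exact b1
    rw [c1, c2]
    simp only [TofWord_cons, ← mul_assoc]
    rw [Tg_braid n i hj]

lemma mats (n k : ℕ) : MatsP n k := by
  induction k with
  | zero =>
    intro l l' _ _ h1 h2 _ _
    rw [List.length_eq_zero_iff] at h1 h2
    rw [h1, h2]
  | succ k IH =>
    intro l l' hl hl' h1 h2 he hinv
    obtain ⟨i, m, rfl⟩ := List.exists_cons_of_length_eq_add_one h1
    obtain ⟨j, m', rfl⟩ := List.exists_cons_of_length_eq_add_one h2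
    rw [valid_cons] at hl hl'
    simp only [wordProd_cons, TofWord_cons, List.length_cons, add_left_inj] at *
    rcases lt_trichotomy i j with h | rfl | h
    · exact mats_step n k IH i j m m' h hl.1 hl'.1 hl.2 hl'.2 h1 h2 he hinv
    · rw [IH m m' hl.2 hl'.2 h1 h2 (mul_left_cancel he)
        (red_tail n i k m hl.1 hl.2 h1 hinv).1]
    · exact (mats_step n k IH j i m' m h hl'.1 hl.1 hl'.2 hl.2 h2 h1 he.symm (he ▸ hinv)).symm

lemma Tw_eq (n : ℕ) (w : Equiv.Perm (Fin n)) (l : List ℕ) (hl : valid n l)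
    (h : l.length = inv n w) (hw : wordProd n l = w) : Tw n w = TofWord n l := by
  obtain ⟨h1, h2, h3⟩ := redWord_spec n w
  exact mats n (inv n w) _ _ h1 hl h2 h (by rw [h3, hw]) (by rw [h3])

lemma Tw_one (n : ℕ) : Tw n 1 = 1 := by
  rw [Tw_eq n 1 [] (by simp [valid]) (by simp [inv_one]) (by simp [wordProd])]
  simp [TofWord]

lemma Tw_asc (n j : ℕ) (hj : j + 1 < n) (w : Equiv.Perm (Fin n))
    (h : pos n w j < pos n w (j + 1)) : Tw n (sgen n j * w) = Tg n j * Tw n w := by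
  obtain ⟨h1, h2, h3⟩ := redWord_spec n w
  rw [Tw_eq n (sgen n j * w) (j :: redWord n w) ((valid_cons _ _ _).2 ⟨hj, h1⟩)
    (by rw [inv_asc n j hj w h]; simp [h2]) (by rw [wordProd_cons, h3]), TofWord_cons]
  rfl

lemma Tw_asc_right (n j : ℕ) (hj : j + 1 < n) (w : Equiv.Perm (Fin n))
    (h : w ⟨j, Nat.lt_of_succ_lt hj⟩ < w ⟨j + 1, hj⟩) : Tw n (w * sgen n j) = Tw n w * Tg n j := by
  obtain ⟨h1, h2, h3⟩ := redWord_spec n w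
  have hinv : inv n (w * sgen n j) = inv n w + 1 := by
    rw [← inv_inv', mul_inv_rev, sgen_inv, inv_asc n j hj, inv_inv']
    unfold pos
    rw [dif_pos (by omega), dif_pos hj, inv_inv]
    exact h
  rw [Tw_eq n (w * sgen n j) (redWord n w ++ [j]) (by
      intro i hi
      rcases List.mem_append.mp hi with hi | hi
      · exact h1 i hi
      · simp at hi; omega)
    (by simp [hinv, h2]) (by rw [wordProd_append, h3]; simp [wordProd])]
  simp [TofWord, Tw]

end HLHecke

namespace HLHecke

/-! ### evaluation homomorphism and regular representation -/

def tinv : HR := LaurentPolynomial.T (-1)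

lemma tt_tinv : tt * tinv = 1 := by
  unfold tt tinv
  rw [← LaurentPolynomial.T_add]; simp

lemma tinv_tt : tinv * tt = 1 := by rw [mul_comm, tt_tinv]

section JM

variable {A : Type} [Ring A] [Algebra HR A]

def jm (T : ℕ → A) : ℕ → A
  | 0 => 1
  | i + 1 => tinv • (T i * jm T i * T i)

def Tinv (T : ℕ → A) (i : ℕ) : A := tinv • (T i + (1 - tt) • 1)

def jmi (T : ℕ → A) : ℕ → A
  | 0 => 1
  | i + 1 => tt • (Tinv T i * jmi T i * Tinv T i)

lemma T_Tinv (x : A) (h : x * x = (tt - 1) • x + tt • 1) :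
    x * (tinv • (x + (1 - tt) • 1)) = 1 ∧ (tinv • (x + (1 - tt) • 1)) * x = 1 := by
  have e : x * x + (1 - tt) • x = tt • 1 := by rw [h]; module
  constructor
  · rw [mul_smul_comm, mul_add, mul_smul_comm, mul_one, e, smul_smul, tinv_tt, one_smul]
  · rw [smul_mul_assoc, add_mul, smul_mul_assoc, one_mul, e, smul_smul, tinv_tt, one_smul]

variable (n : ℕ) (T : ℕ → A)
  (hquad : ∀ j, j + 1 < n → T j * T j = (tt - 1) • T j + tt • 1)
  (hbraid : ∀ j, j + 2 < n → T j * T (j + 1) * T j = T (j + 1) * T j * T (j + 1))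
  (hcomm : ∀ j k, j + 1 < k → k + 1 < n → T j * T k = T k * T j)

include hcomm in
lemma jm_hi (i k : ℕ) (hik : i < k) (hk : k + 1 < n) : Commute (T k) (jm T i) := by
  induction i with
  | zero => exact Commute.one_right _
  | succ i ih =>
    have h1 := ih (by omega)
    have h2 : Commute (T k) (T i) := (hcomm i k (by omega) hk).symm
    exact ((h2.mul_right h1).mul_right h2).smul_right _

include hcomm hbraid in
lemma jm_lo (k d : ℕ) (hk : k + 2 + d < n) : Commute (T k) (jm T (k + 2 + d)) := by
  induction d with
  | zero =>
    show Commute (T k) (tinv • (T (k + 1) * (tinv • (T k * jm T k * T k)) * T (k + 1)))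
    apply Commute.smul_right
    rw [mul_smul_comm, smul_mul_assoc]
    apply Commute.smul_right
    have h1 : T (k + 1) * jm T k = jm T k * T (k + 1) :=
      jm_hi n T hcomm k (k + 1) (by omega) (by omega)
    have h2 := hbraid k (by omega)
    show T k * _ = _ * T k
    calc T k * (T (k + 1) * (T k * jm T k * T k) * T (k + 1))
        = (T k * T (k + 1) * T k) * jm T k * T k * T (k + 1) := by simp only [mul_assoc]
      _ = T (k + 1) * T k * (T (k + 1) * jm T k) * T k * T (k + 1) := by
          rw [h2]; simp only [mul_assoc]
      _ = T (k + 1) * T k * jm T k * (T (k + 1) * T k * T (k + 1)) := by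
          rw [h1]; simp only [mul_assoc]
      _ = T (k + 1) * (T k * jm T k * T k) * T (k + 1) * T k := by
          rw [← h2]; simp only [mul_assoc]
  | succ d ih =>
    have h1 := ih (by omega)
    have h2 : Commute (T k) (T (k + 2 + d)) := hcomm k _ (by omega) (by omega)
    exact ((h2.mul_right h1).mul_right h2).smul_right _

include hcomm hbraid in
lemma jm_comm (i i' : ℕ) (h : i < i') (hi : i' < n) : Commute (jm T i) (jm T i') := by
  induction i with
  | zero => exact Commute.one_left _
  | succ i ih =>
    have h1 := ih (by omega)
    have h2 : Commute (T i) (jm T i') := by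
      obtain ⟨d, rfl⟩ : ∃ d, i' = i + 2 + d := ⟨i' - (i + 2), by omega⟩
      exact jm_lo n T hbraid hcomm i d hi
    exact ((h2.mul_left h1).mul_left h2).smul_left _

include hquad in
lemma jm_inv (i : ℕ) (hi : i < n) : jm T i * jmi T i = 1 ∧ jmi T i * jm T i = 1 := by
  induction i with
  | zero => simp [jm, jmi]
  | succ i ih =>
    obtain ⟨h1, h2⟩ := ih (by omega)
    obtain ⟨h3, h4⟩ := T_Tinv (T i) (hquad i hi)
    change T i * Tinv T i = 1 at h3
    change Tinv T i * T i = 1 at h4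
    constructor
    · show (tinv • (T i * jm T i * T i)) * (tt • (Tinv T i * jmi T i * Tinv T i)) = 1
      rw [smul_mul_smul_comm, tinv_tt, one_smul]
      calc _ = T i * jm T i * (T i * Tinv T i) * jmi T i * Tinv T i := by simp only [mul_assoc]
        _ = T i * (jm T i * jmi T i) * Tinv T i := by rw [h3]; simp only [mul_assoc, one_mul]
        _ = 1 := by rw [h1, mul_one, h3]
    · show (tt • (Tinv T i * jmi T i * Tinv T i)) * (tinv • (T i * jm T i * T i)) = 1
      rw [smul_mul_smul_comm, tt_tinv, one_smul]
      calc _ = Tinv T i * jmi T i * (Tinv T i * T i) * jm T i * T i := by simp only [mul_assoc]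
        _ = Tinv T i * (jmi T i * jm T i) * T i := by rw [h4]; simp only [mul_assoc, one_mul]
        _ = 1 := by rw [h2, mul_one, h4]

def evalGen : AGen n → A
  | AGen.T j => T j
  | AGen.X i => jm T i
  | AGen.Xinv i => jmi T i

include hquad hbraid hcomm in
lemma exists_evalHom (hjunk : ∀ j, ¬ j + 1 < n → T j = 1) :
    ∃ φ : H n →ₐ[HR] A, ∀ j, φ (Tg n j) = T j := by
  have key : ∀ ⦃x y : FA n⦄, ARel n x y →
      FreeAlgebra.lift HR (evalGen n T) x = FreeAlgebra.lift HR (evalGen n T) y := by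
    have eT : ∀ j, FreeAlgebra.lift HR (evalGen n T) (fT n j) = T j := fun j => by
      simp [fT, evalGen]
    have eX : ∀ j, FreeAlgebra.lift HR (evalGen n T) (fX n j) = jm T j := fun j => by
      simp [fX, evalGen]
    have eXi : ∀ j, FreeAlgebra.lift HR (evalGen n T) (fXi n j) = jmi T j := fun j => by
      simp [fXi, evalGen]
    intro x y h
    cases h with
    | junk j h => rw [eT, map_one, hjunk j h]
    | quad j h =>
      rw [map_mul, map_add, map_smul, eT, hquad j h, AlgHom.commutes,
        Algebra.algebraMap_eq_smul_one]
    | braid j h => simp only [map_mul, eT]; exact hbraid j h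
    | commT j k h1 h2 => simp only [map_mul, eT]; exact hcomm j k h1 h2
    | commX i i' =>
      simp only [map_mul, eX]
      rcases lt_trichotomy (i : ℕ) i' with h | h | h
      · exact jm_comm n T hbraid hcomm i i' h i'.isLt
      · rw [h]
      · exact (jm_comm n T hbraid hcomm i' i h i.isLt).symm
    | XinvL i => simp only [map_mul, map_one, eX, eXi]; exact (jm_inv n T hquad i i.isLt).1
    | XinvR i => simp only [map_mul, map_one, eX, eXi]; exact (jm_inv n T hquad i i.isLt).2
    | TXT j h =>
      simp only [map_mul, map_smul, eX, eT]
      show _ = tt • (tinv • (T j * jm T j * T j))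
      rw [smul_smul, tt_tinv, one_smul]
    | TXcomm j h i h1 h2 =>
      simp only [map_mul, eX, eT]
      rcases Nat.lt_or_ge (i : ℕ) j with h' | h'
      · exact jm_hi n T hcomm i j h' h
      · have := i.isLt
        obtain ⟨d, hd⟩ : ∃ d, (i : ℕ) = j + 2 + d := ⟨i - (j + 2), by omega⟩
        rw [hd]
        exact jm_lo n T hbraid hcomm j d (by omega)
  refine ⟨RingQuot.liftAlgHom HR ⟨FreeAlgebra.lift HR (evalGen n T), key⟩, fun j => ?_⟩
  unfold Tg
  rw [RingQuot.liftAlgHom_mkAlgHom_apply]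
  simp [fT, evalGen]

end JM

def opT (n j : ℕ) : Module.End HR (Equiv.Perm (Fin n) → HR) where
  toFun f := fun w => if j + 1 < n then
      (if pos n w j < pos n w (j + 1) then tt * f (sgen n j * w)
        else f (sgen n j * w) + (tt - 1) * f w)
    else f w
  map_add' f g := by
    funext w
    simp only [Pi.add_apply]
    split_ifs <;> ring
  map_smul' c f := by
    funext w
    simp only [Pi.smul_apply, smul_eq_mul, RingHom.id_apply]
    split_ifs <;> ring

lemma opT_apply (n j : ℕ) (hj : j + 1 < n) (f : Equiv.Perm (Fin n) → HR)
    (w : Equiv.Perm (Fin n)) : opT n j f w = if pos n w j < pos n w (j + 1)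
      then tt * f (sgen n j * w) else f (sgen n j * w) + (tt - 1) * f w := by
  show (if j + 1 < n then _ else _) = _
  rw [if_pos hj]

lemma exists_regHom (n : ℕ) :
    ∃ φ : H n →ₐ[HR] Module.End HR (Equiv.Perm (Fin n) → HR), ∀ j, φ (Tg n j) = opT n j := by
  apply exists_evalHom n (opT n)
  · intro j hj
    refine LinearMap.ext fun f => ?_
    funext w
    have := pos_ne n w j (j + 1) (by omega) hj (by omega)
    simp only [Module.End.mul_apply, LinearMap.add_apply, LinearMap.smul_apply,
      Module.End.one_apply, Pi.add_apply, Pi.smul_apply, smul_eq_mul, opT_apply n j hj,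
      pos_s n j hj, sgen_cancel]
    simp only [if_true, Nat.succ_ne_self, if_false]
    split_ifs <;> first | omega | ring
  · intro j hj
    have h1 : j + 1 < n := by omega
    refine LinearMap.ext fun f => ?_
    funext w
    have n1 := pos_ne n w j (j + 1) (by omega) (by omega) (by omega)
    have n2 := pos_ne n w j (j + 2) (by omega) (by omega) (by omega)
    have n3 := pos_ne n w (j + 1) (j + 2) (by omega) (by omega) (by omega)
    have br : sgen n (j + 1) * (sgen n j * (sgen n (j + 1) * w)) =
        sgen n j * (sgen n (j + 1) * (sgen n j * w)) := by
      simpa only [mul_assoc] using congrArg (· * w) (sgen_braid n j hj).symm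
    have i1 : j + 1 ≠ j := by omega
    have i2 : j + 1 + 1 ≠ j := by omega
    have i3 : j + 1 + 1 ≠ j + 1 := by omega
    have i4 : j ≠ j + 1 := by omega
    have i5 : j ≠ j + 1 + 1 := by omega
    have i6 : j + 1 ≠ j + 1 + 1 := by omega
    simp only [Module.End.mul_apply, opT_apply n j h1, opT_apply n (j + 1) hj,
      pos_s n j h1, pos_s n (j + 1) hj, sgen_cancel, br, if_true, i1, i2, i3, i4, i5, i6, if_false]
    generalize pos n w j = p at *
    generalize pos n w (j + 1) = q at *
    generalize pos n w (j + 1 + 1) = r at *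
    clear br
    split_ifs <;> first | omega | ring
  · intro j k hjk hk
    have hj : j + 1 < n := by omega
    refine LinearMap.ext fun f => ?_
    funext w
    have br : sgen n j * (sgen n k * w) = sgen n k * (sgen n j * w) := by
      simpa only [mul_assoc] using congrArg (· * w) (sgen_far n j k hjk hk)
    have i1 : j ≠ k := by omega
    have i2 : j ≠ k + 1 := by omega
    have i3 : j + 1 ≠ k := by omega
    have i4 : j + 1 ≠ k + 1 := by omega
    simp only [Module.End.mul_apply, opT_apply n j hj, opT_apply n k hk,
      pos_s n j hj, pos_s n k hk, br, i1, i2, i3, i4, i1.symm, i2.symm, i3.symm, i4.symm, if_false]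
    split_ifs <;> ring
  · intro j hj
    refine LinearMap.ext fun f => ?_
    funext w
    show (if j + 1 < n then _ else _) = _
    rw [if_neg hj]
    rfl

def regHom (n : ℕ) : H n →ₐ[HR] Module.End HR (Equiv.Perm (Fin n) → HR) :=
  (exists_regHom n).choose

lemma regHom_Tg (n j : ℕ) : regHom n (Tg n j) = opT n j := (exists_regHom n).choose_spec j

/-- coefficient of `T_w` -/
def coeff (n : ℕ) : H n →ₗ[HR] (Equiv.Perm (Fin n) → HR) where
  toFun x := regHom n x (Pi.single 1 1)
  map_add' x y := by simp
  map_smul' c x := by simp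

lemma coeff_Tg_mul (n j : ℕ) (hj : j + 1 < n) (x : H n) (w : Equiv.Perm (Fin n)) :
    coeff n (Tg n j * x) w = if pos n w j < pos n w (j + 1)
      then tt * coeff n x (sgen n j * w) else coeff n x (sgen n j * w) + (tt - 1) * coeff n x w := by
  show regHom n (Tg n j * x) (Pi.single 1 1) w = _
  rw [map_mul, regHom_Tg, Module.End.mul_apply, opT_apply n j hj]
  rfl

lemma Tw_induction (n : ℕ) (P : Equiv.Perm (Fin n) → Prop) (h1 : P 1)
    (hs : ∀ j w, j + 1 < n → pos n w j < pos n w (j + 1) → P w → P (sgen n j * w)) (w) : P w := by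
  induction hk : inv n w using Nat.strong_induction_on generalizing w with
  | _ k ih =>
    by_cases hw : w = 1
    · rw [hw]; exact h1
    · obtain ⟨j, hj, hd⟩ := exists_desc n w hw
      have h2 := inv_desc n j hj w hd
      have h3 := hs j (sgen n j * w) hj (by
        have := pos_ne n w j (j + 1) (by omega) hj (by omega)
        rw [pos_s n j hj, pos_s n j hj]
        simp
        omega) (ih (inv n (sgen n j * w)) (by omega) (sgen n j * w) rfl)
      rwa [sgen_cancel] at h3

lemma coeff_Tw (n : ℕ) (v w : Equiv.Perm (Fin n)) :
    coeff n (Tw n v) w = if w = v then 1 else 0 := by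
  revert w
  apply Tw_induction n (fun v => ∀ w, coeff n (Tw n v) w = if w = v then 1 else 0)
  · intro w
    show regHom n (Tw n 1) (Pi.single 1 1) w = _
    rw [Tw_one, map_one, Module.End.one_apply, Pi.single_apply]
  · intro j v hj ha ih w
    rw [Tw_asc n j hj v ha, coeff_Tg_mul n j hj, ih, ih]
    have e : sgen n j * w = v ↔ w = sgen n j * v := by
      constructor
      · rintro rfl; rw [sgen_cancel]
      · rintro rfl; rw [sgen_cancel]
    rw [if_congr e rfl rfl]
    by_cases h1 : w = sgen n j * v
    · have : ¬ pos n w j < pos n w (j + 1) := by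
        rw [h1, pos_s n j hj, pos_s n j hj]; simp; omega
      have h2 : w ≠ v := by
        rintro rfl; exact this ha
      simp [h1, h1 ▸ h2, h1 ▸ this]
    · rw [if_neg h1]
      by_cases h2 : w = v
      · rw [if_pos (h2 ▸ ha)]; simp
      · simp [h2]

end HLHecke

namespace HLHecke

/-! ### columns and coset representatives -/

lemma papp_inv {n : ℕ} (w : Equiv.Perm (Fin n)) (x : Fin n) : w (w⁻¹ x) = x :=
  w.apply_symm_apply x

lemma pinv_app {n : ℕ} (w : Equiv.Perm (Fin n)) (x : Fin n) : w⁻¹ (w x) = x :=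
  w.symm_apply_apply x

lemma stab_iff (n ℓ : ℕ) (w : Equiv.Perm (Fin n)) :
    wAct n w (varpi n ℓ) = varpi n ℓ ↔ ∀ x, ((w x : Fin n) : ℕ) < ℓ ↔ (x : ℕ) < ℓ := by
  have e : ∀ i j : Fin n, varpi n ℓ i = varpi n ℓ j ↔ ((i : ℕ) < ℓ ↔ (j : ℕ) < ℓ) := by
    intro i j
    unfold varpi
    split_ifs <;> simp_all <;> omega
  constructor
  · intro h x
    have := congrFun h (w x)
    unfold wAct at this
    rw [pinv_app, e] at this
    exact this.symm
  · intro h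
    funext i
    unfold wAct
    rw [e, ← h (w⁻¹ i), papp_inv]

lemma colPerm_lt (n : ℕ) (C : Finset (Fin n)) (x : Fin n) (h : (x : ℕ) < C.card) :
    colPerm n C x = (C.orderIsoOfFin rfl ⟨x, h⟩ : Fin n) := by
  have e : finCongr ((Nat.add_sub_cancel' (col_card_le n C)).symm) x =
      Fin.castAdd (n - C.card) ⟨x, h⟩ := rfl
  simp only [colPerm, Equiv.trans_apply, e, finSumFinEquiv_symm_apply_castAdd]
  rfl

lemma colPerm_ge (n : ℕ) (C : Finset (Fin n)) (x : Fin n) (h : ¬ (x : ℕ) < C.card) :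
    colPerm n C x = (Cᶜ.orderIsoOfFin (k := n - C.card) (by simp [Finset.card_compl])
      ⟨x - C.card, by have := x.isLt; omega⟩ : Fin n) := by
  have e : finCongr ((Nat.add_sub_cancel' (col_card_le n C)).symm) x =
      Fin.natAdd C.card (⟨x - C.card, by have := x.isLt; omega⟩ : Fin (n - C.card)) := by
    ext; simp; omega
  simp only [colPerm, Equiv.trans_apply, e, finSumFinEquiv_symm_apply_natAdd]
  rfl

def isU (n ℓ : ℕ) (C : Finset (Fin n)) (u : Equiv.Perm (Fin n)) : Prop :=
  (∀ x, u x ∈ C ↔ (x : ℕ) < ℓ) ∧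
  (∀ x y : Fin n, x < y → ((x : ℕ) < ℓ ↔ (y : ℕ) < ℓ) → u x < u y)

lemma isU_colPerm (n : ℕ) (C : Finset (Fin n)) : isU n C.card C (colPerm n C) := by
  constructor
  · intro x
    by_cases h : (x : ℕ) < C.card
    · rw [colPerm_lt n C x h]
      simp [h]
    · rw [colPerm_ge n C x h]
      simp only [h, iff_false]
      exact Finset.mem_compl.mp (Subtype.property _)
  · intro x y hxy he
    by_cases h : (x : ℕ) < C.card
    · rw [colPerm_lt n C x h, colPerm_lt n C y (he.1 h)]
      simpa using hxy
    · rw [colPerm_ge n C x h, colPerm_ge n C y (fun h' => h (he.2 h'))]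
      have : (x : ℕ) < y := hxy
      simp only [Subtype.coe_lt_coe, OrderIso.lt_iff_lt, Fin.mk_lt_mk]
      omega

lemma pos_eq (n : ℕ) (w : Equiv.Perm (Fin n)) (i : ℕ) (hi : i < n) :
    pos n w i = (w⁻¹ ⟨i, hi⟩ : Fin n) := by
  unfold pos; rw [dif_pos hi]

lemma isU_unique (n ℓ : ℕ) (C : Finset (Fin n)) (u u' : Equiv.Perm (Fin n))
    (h : isU n ℓ C u) (h' : isU n ℓ C u') : u = u' := by
  have hv : ∀ x, ((u⁻¹ (u' x) : Fin n) : ℕ) < ℓ ↔ (x : ℕ) < ℓ := by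
    intro x
    rw [← h.1, papp_inv, h'.1]
  have : (u⁻¹ * u')⁻¹ = 1 := by
    apply pos_ext_one
    intro j hj
    rw [pos_eq n _ j (by omega), pos_eq n _ (j + 1) hj, inv_inv, Equiv.Perm.mul_apply,
      Equiv.Perm.mul_apply]
    have h1 := hv ⟨j, Nat.lt_of_succ_lt hj⟩
    have h2 := hv ⟨j + 1, hj⟩
    simp only at h1 h2
    by_cases hb : j < ℓ ↔ j + 1 < ℓ
    · have h3 := h'.2 ⟨j, Nat.lt_of_succ_lt hj⟩ ⟨j + 1, hj⟩ (by simp) hb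
      by_contra h4
      rw [not_lt, ← Fin.le_def] at h4
      rcases h4.lt_or_eq with h5 | h5
      · have h6 := h.2 _ _ h5 (by omega)
        rw [papp_inv, papp_inv] at h6
        exact absurd h3 (not_lt.mpr h6.le)
      · have := u'.injective (u⁻¹.injective h5)
        simp at this
    · omega
  rw [inv_eq_one, inv_mul_eq_one] at this
  exact this

lemma card_sCol (n j : ℕ) (C : Finset (Fin n)) : (sCol n j C).card = C.card :=
  Finset.card_image_of_injective _ (Equiv.injective _)

lemma mem_sCol (n j : ℕ) (C : Finset (Fin n)) (x : Fin n) :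
    x ∈ sCol n j C ↔ sgen n j x ∈ C := by
  unfold sCol
  rw [Finset.mem_image]
  constructor
  · rintro ⟨y, hy, rfl⟩
    rwa [← Equiv.Perm.mul_apply, sgen_mul_self]
  · intro h
    exact ⟨_, h, by rw [← Equiv.Perm.mul_apply, sgen_mul_self]; rfl⟩

lemma sCol_sCol (n j : ℕ) (C : Finset (Fin n)) : sCol n j (sCol n j C) = C := by
  ext x
  rw [mem_sCol, mem_sCol, ← Equiv.Perm.mul_apply, sgen_mul_self]; rfl

lemma sgen_left (n j : ℕ) (hj : j + 1 < n) : sgen n j ⟨j, Nat.lt_of_succ_lt hj⟩ = ⟨j + 1, hj⟩ := by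
  ext; rw [sgen_val n j hj]; simp

lemma sgen_right (n j : ℕ) (hj : j + 1 < n) : sgen n j ⟨j + 1, hj⟩ = ⟨j, Nat.lt_of_succ_lt hj⟩ := by
  ext; rw [sgen_val n j hj]; simp

lemma colPerm_sCol (n j : ℕ) (hj : j + 1 < n) (C : Finset (Fin n))
    (h1 : (⟨j, Nat.lt_of_succ_lt hj⟩ : Fin n) ∈ C) (h2 : (⟨j + 1, hj⟩ : Fin n) ∉ C) :
    colPerm n (sCol n j C) = sgen n j * colPerm n C := by
  have hU := isU_colPerm n C
  apply isU_unique n C.card (sCol n j C)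
  · have := isU_colPerm n (sCol n j C)
    rwa [card_sCol] at this
  · constructor
    · intro x
      rw [mem_sCol, ← Equiv.Perm.mul_apply, sgen_cancel, hU.1]
    · intro x y hxy he
      have h3 := hU.2 x y hxy he
      have h4 := hU.1 x
      have h5 := hU.1 y
      have h6 : ¬ ((colPerm n C x : ℕ) = j ∧ (colPerm n C y : ℕ) = j + 1) := by
        rintro ⟨a, b⟩
        have a' : colPerm n C x = ⟨j, Nat.lt_of_succ_lt hj⟩ := Fin.ext a
        have b' : colPerm n C y = ⟨j + 1, hj⟩ := Fin.ext b
        rw [a'] at h4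
        rw [b'] at h5
        tauto
      rw [Fin.lt_def] at h3 ⊢
      simp only [Equiv.Perm.mul_apply, sgen_val n j hj]
      generalize ((colPerm n C x : Fin n) : ℕ) = p at *
      generalize ((colPerm n C y : Fin n) : ℕ) = q at *
      split_ifs <;> omega

lemma sCol_fix (n j : ℕ) (hj : j + 1 < n) (C : Finset (Fin n))
    (h : (⟨j, Nat.lt_of_succ_lt hj⟩ : Fin n) ∈ C ↔ (⟨j + 1, hj⟩ : Fin n) ∈ C) : sCol n j C = C := by
  ext x
  rw [mem_sCol]
  by_cases h1 : x = ⟨j, Nat.lt_of_succ_lt hj⟩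
  · subst h1; rw [sgen_left n j hj, h]
  by_cases h2 : x = ⟨j + 1, hj⟩
  · subst h2; rw [sgen_right n j hj, h]
  · have : sgen n j x = x := by
      ext; rw [sgen_val n j hj]
      rw [Fin.ext_iff] at h1 h2
      simp only at h1 h2
      simp [h1, h2]
    rw [this]

lemma pos_col (n : ℕ) (C : Finset (Fin n)) (v : Equiv.Perm (Fin n))
    (hv : wAct n v (varpi n C.card) = varpi n C.card) (i : ℕ) (hi : i < n) :
    pos n (colPerm n C * v) i < C.card ↔ (⟨i, hi⟩ : Fin n) ∈ C := by
  rw [stab_iff] at hv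
  rw [pos_eq n _ i hi, ← hv, ← (isU_colPerm n C).1, ← Equiv.Perm.mul_apply,
    papp_inv]

lemma colPerm_fix (n j : ℕ) (hj : j + 1 < n) (C : Finset (Fin n))
    (h : (⟨j, Nat.lt_of_succ_lt hj⟩ : Fin n) ∈ C ↔ (⟨j + 1, hj⟩ : Fin n) ∈ C) :
    ∃ k, ∃ hk : k + 1 < n, sgen n j * colPerm n C = colPerm n C * sgen n k ∧
      (k < C.card ↔ k + 1 < C.card) ∧ colPerm n C ⟨k, Nat.lt_of_succ_lt hk⟩ = ⟨j, Nat.lt_of_succ_lt hj⟩ ∧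
      colPerm n C ⟨k + 1, hk⟩ = ⟨j + 1, hj⟩ := by
  have hU := isU_colPerm n C
  set u := colPerm n C with hu
  obtain ⟨x, hx⟩ := u.surjective ⟨j, Nat.lt_of_succ_lt hj⟩
  obtain ⟨y, hy⟩ := u.surjective ⟨j + 1, hj⟩
  have hb : (x : ℕ) < C.card ↔ (y : ℕ) < C.card := by
    rw [← hU.1, ← hU.1, hx, hy, h]
  have hxy : x < y := by
    rcases lt_trichotomy x y with h1 | h1 | h1
    · exact h1
    · subst h1; rw [hx] at hy; simp at hy
    · have := hU.2 y x h1 hb.symm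
      rw [hx, hy] at this
      simp at this
  have hxy' : (x : ℕ) < y := hxy
  have hyn := y.isLt
  have hs : (y : ℕ) = x + 1 := by
    by_contra hne
    have h1 := hU.2 x ⟨x + 1, by omega⟩ (by simp [Fin.lt_def]) (by simp only; omega)
    have h2 := hU.2 ⟨x + 1, by omega⟩ y (by simp only [Fin.lt_def]; omega) (by simp only; omega)
    rw [hx, Fin.lt_def] at h1
    rw [hy, Fin.lt_def] at h2
    simp only at h1 h2
    omega
  have ey : y = ⟨x + 1, by omega⟩ := Fin.ext hs
  refine ⟨x, by omega, ?_, by omega, hx, by rw [← ey]; exact hy⟩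
  have e1 : sgen n j = Equiv.swap (u x) (u y) := by
    unfold sgen; rw [dif_pos hj, hx, hy]
  have e2 : sgen n x = Equiv.swap x y := by
    unfold sgen; rw [dif_pos (by omega)]; congr 1; exact ey.symm
  rw [e1, e2, Equiv.mul_swap_eq_swap_mul]

lemma stab_mul (n ℓ : ℕ) (v w : Equiv.Perm (Fin n)) (hv : wAct n v (varpi n ℓ) = varpi n ℓ)
    (hw : wAct n w (varpi n ℓ) = varpi n ℓ) : wAct n (v * w) (varpi n ℓ) = varpi n ℓ := by
  rw [stab_iff] at *
  intro x
  rw [Equiv.Perm.mul_apply, hv, hw]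

lemma stab_mul_left (n ℓ : ℕ) (v w : Equiv.Perm (Fin n)) (hv : wAct n v (varpi n ℓ) = varpi n ℓ) :
    wAct n (v * w) (varpi n ℓ) = varpi n ℓ ↔ wAct n w (varpi n ℓ) = varpi n ℓ := by
  rw [stab_iff] at *
  rw [stab_iff]
  simp only [Equiv.Perm.mul_apply, hv]

lemma stab_sgen (n ℓ k : ℕ) (hk : k + 1 < n) (h : k < ℓ ↔ k + 1 < ℓ) :
    wAct n (sgen n k) (varpi n ℓ) = varpi n ℓ := by
  rw [stab_iff]
  intro x
  rw [sgen_val n k hk]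
  split_ifs <;> omega

lemma Tw_mul (n : ℕ) (C : Finset (Fin n)) (v : Equiv.Perm (Fin n))
    (hv : wAct n v (varpi n C.card) = varpi n C.card) :
    Tw n (colPerm n C * v) = Tw n (colPerm n C) * Tw n v := by
  induction hk : inv n v using Nat.strong_induction_on generalizing v with
  | _ k ih =>
    by_cases h1 : v = 1
    · subst h1; rw [Tw_one, mul_one, mul_one]
    · obtain ⟨j, hj, hd⟩ := exists_desc n v⁻¹ (by simpa using h1)
      have hinv := inv_desc n j hj v⁻¹ hd
      rw [inv_inv'] at hinv
      have hne := pos_ne n v⁻¹ j (j + 1) (by omega) hj (by omega)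
      rw [pos_eq n _ j (by omega), pos_eq n _ (j + 1) hj, inv_inv] at hd hne
      have hv' := (stab_iff _ _ _).1 hv
      have b1 := hv' ⟨j, Nat.lt_of_succ_lt hj⟩
      have b2 := hv' ⟨j + 1, hj⟩
      simp only at b1 b2
      have hsj := stab_sgen n C.card j hj (by omega)
      have hvs := stab_mul n C.card v (sgen n j) hv hsj
      have hvs' := (stab_iff _ _ _).1 hvs
      have hih := ih (inv n (v * sgen n j)) (by
        rw [← inv_inv', mul_inv_rev, sgen_inv]; omega) (v * sgen n j) hvs rfl
      have l1 : (v * sgen n j) ⟨j, Nat.lt_of_succ_lt hj⟩ < (v * sgen n j) ⟨j + 1, hj⟩ := by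
        rw [Equiv.Perm.mul_apply, Equiv.Perm.mul_apply, sgen_left n j hj, sgen_right n j hj,
          Fin.lt_def]
        omega
      have l2 := (isU_colPerm n C).2 _ _ l1 (by
        rw [hvs', hvs']; simp only; omega)
      rw [← Equiv.Perm.mul_apply, ← Equiv.Perm.mul_apply] at l2
      have t1 := Tw_asc_right n j hj _ l1
      have t2 := Tw_asc_right n j hj _ l2
      simp only [mul_assoc, sgen_mul_self, mul_one] at t1 t2
      rw [t1, t2, hih, mul_assoc]

/-! ### spans and coefficients -/

def Sp (n : ℕ) : Submodule HR (H n) := Submodule.span HR (Set.range (Tw n))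

lemma Tw_mem_Sp (n : ℕ) (w : Equiv.Perm (Fin n)) : Tw n w ∈ Sp n :=
  Submodule.subset_span ⟨w, rfl⟩

lemma span_eq (n : ℕ) (W : Finset (Equiv.Perm (Fin n))) (x : H n)
    (hx : x ∈ Submodule.span HR (Tw n '' (W : Set (Equiv.Perm (Fin n))))) :
    x = ∑ w ∈ W, coeff n x w • Tw n w := by
  induction hx using Submodule.span_induction with
  | mem x h =>
    obtain ⟨v, hv, rfl⟩ := h
    rw [Finset.sum_eq_single v]
    · rw [coeff_Tw, if_pos rfl, one_smul]
    · intro w _ hw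
      rw [coeff_Tw, if_neg hw, zero_smul]
    · intro h; exact absurd hv h
  | zero => simp
  | add x y _ _ hx hy =>
    simp only [map_add, Pi.add_apply, add_smul, Finset.sum_add_distrib]
    rw [← hx, ← hy]
  | smul c x _ hx =>
    simp only [map_smul, Pi.smul_apply, smul_assoc]
    rw [← Finset.smul_sum, ← hx]

lemma Sp_ext (n : ℕ) (x y : H n) (hx : x ∈ Sp n) (hy : y ∈ Sp n)
    (h : ∀ w, coeff n x w = coeff n y w) : x = y := by
  have e : Sp n = Submodule.span HR (Tw n '' ((Finset.univ : Finset (Equiv.Perm (Fin n))) :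
      Set (Equiv.Perm (Fin n)))) := by
    simp [Sp]
  rw [e] at hx hy
  rw [span_eq n _ x hx, span_eq n _ y hy]
  simp only [h]

lemma mem_stabFinset (n : ℕ) (lam : Fin n → ℤ) (w : Equiv.Perm (Fin n)) :
    w ∈ stabFinset n lam ↔ wAct n w lam = lam := by simp [stabFinset]

lemma Hpara_eq (n : ℕ) (lam : Fin n → ℤ) (x : H n) (hx : x ∈ HparaM n lam) :
    x = ∑ w ∈ stabFinset n lam, coeff n x w • Tw n w := by
  apply span_eq
  have : ((stabFinset n lam : Finset _) : Set (Equiv.Perm (Fin n))) =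
      {w | wAct n w lam = lam} := by
    ext w; simp [stabFinset]
  rw [this]
  exact hx

lemma Tg_mul_Tw (n j : ℕ) (hj : j + 1 < n) (w : Equiv.Perm (Fin n)) :
    Tg n j * Tw n w = if pos n w j < pos n w (j + 1) then Tw n (sgen n j * w)
      else (tt - 1) • Tw n w + tt • Tw n (sgen n j * w) := by
  split_ifs with h
  · rw [Tw_asc n j hj w h]
  · have h1 := Tw_asc n j hj (sgen n j * w) (by
      have := pos_ne n w j (j + 1) (by omega) hj (by omega)
      rw [pos_s n j hj, pos_s n j hj]
      simp
      omega)
    rw [sgen_cancel] at h1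
    rw [h1, ← mul_assoc, Tg_quad n j hj, add_mul, smul_mul_assoc, smul_mul_assoc, one_mul]

lemma Sp_Tg (n j : ℕ) (hj : j + 1 < n) (x : H n) (hx : x ∈ Sp n) : Tg n j * x ∈ Sp n := by
  induction hx using Submodule.span_induction with
  | mem x h =>
    obtain ⟨v, rfl⟩ := h
    rw [Tg_mul_Tw n j hj]
    split_ifs
    · exact Tw_mem_Sp _ _
    · exact add_mem (Submodule.smul_mem _ _ (Tw_mem_Sp _ _))
        (Submodule.smul_mem _ _ (Tw_mem_Sp _ _))
  | zero => simp
  | add x y _ _ hx hy => rw [mul_add]; exact add_mem hx hy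
  | smul c x _ hx => rw [mul_smul_comm]; exact Submodule.smul_mem _ _ hx

lemma Hpara_Tg (n ℓ j : ℕ) (hj : j + 1 < n) (h : j < ℓ ↔ j + 1 < ℓ) (x : H n)
    (hx : x ∈ HparaM n (varpi n ℓ)) : Tg n j * x ∈ HparaM n (varpi n ℓ) := by
  have hs := stab_sgen n ℓ j hj h
  induction hx using Submodule.span_induction with
  | mem x h =>
    obtain ⟨v, hv, rfl⟩ := h
    have m1 : Tw n v ∈ HparaM n (varpi n ℓ) := Submodule.subset_span ⟨v, hv, rfl⟩
    have m2 : Tw n (sgen n j * v) ∈ HparaM n (varpi n ℓ) :=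
      Submodule.subset_span ⟨_, stab_mul n ℓ _ _ hs hv, rfl⟩
    rw [Tg_mul_Tw n j hj]
    split_ifs
    · exact m2
    · exact add_mem (Submodule.smul_mem _ _ m1) (Submodule.smul_mem _ _ m2)
  | zero => simp
  | add x y _ _ hx hy => rw [mul_add]; exact add_mem hx hy
  | smul c x _ hx => rw [mul_smul_comm]; exact Submodule.smul_mem _ _ hx

lemma Hpara_le_Sp (n : ℕ) (lam : Fin n → ℤ) : HparaM n lam ≤ Sp n := by
  apply Submodule.span_mono
  rintro _ ⟨w, _, rfl⟩
  exact ⟨w, rfl⟩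

def hcoef (n : ℕ) (x : H n) (F : Finset (Fin n)) : H n :=
  ∑ v ∈ stabFinset n (varpi n F.card), coeff n x (colPerm n F * v) • Tw n v

lemma hcoef_mem (n : ℕ) (x : H n) (F : Finset (Fin n)) :
    hcoef n x F ∈ HparaM n (varpi n F.card) := by
  apply Submodule.sum_mem
  intro v hv
  exact Submodule.smul_mem _ _ (Submodule.subset_span ⟨v, (mem_stabFinset _ _ _).1 hv, rfl⟩)

lemma coeff_hcoef (n : ℕ) (x : H n) (F : Finset (Fin n)) (v : Equiv.Perm (Fin n)) 
    (hv : wAct n v (varpi n F.card) = varpi n F.card) :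
    coeff n (hcoef n x F) v = coeff n x (colPerm n F * v) := by
  unfold hcoef
  rw [map_sum, Finset.sum_apply, Finset.sum_eq_single v]
  · simp [coeff_Tw]
  · intro w _ hw
    simp [coeff_Tw, hw.symm]
  · intro h; exact absurd ((mem_stabFinset _ _ _).2 hv) h

lemma col_inj (n : ℕ) (F G : Finset (Fin n)) (v v' : Equiv.Perm (Fin n)) (hc : F.card = G.card)
    (hv : wAct n v (varpi n F.card) = varpi n F.card)
    (hv' : wAct n v' (varpi n G.card) = varpi n G.card)
    (h : colPerm n F * v = colPerm n G * v') : F = G := by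
  ext ⟨i, hi⟩
  rw [← pos_col n F v hv, ← pos_col n G v' hv', h, hc]

lemma coeff_u_mul (n : ℕ) (F G : Finset (Fin n)) (hc : F.card = G.card) (g : H n)
    (hg : g ∈ HparaM n (varpi n G.card)) (v : Equiv.Perm (Fin n))
    (hv : wAct n v (varpi n F.card) = varpi n F.card) :
    coeff n (Tw n (colPerm n G) * g) (colPerm n F * v) = if F = G then coeff n g v else 0 := by
  induction hg using Submodule.span_induction with
  | mem x h =>
    obtain ⟨v', hv', rfl⟩ := h
    rw [← Tw_mul n G v' hv', coeff_Tw, coeff_Tw]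
    by_cases hFG : F = G
    · subst hFG; simp
    · rw [if_neg hFG, if_neg]
      intro h
      exact hFG (col_inj n F G v v' hc hv hv' h)
  | zero => simp
  | add x y _ _ hx hy =>
    simp only [mul_add, map_add, Pi.add_apply, hx, hy]
    split_ifs <;> simp
  | smul c x _ hx =>
    simp only [mul_smul_comm, map_smul, Pi.smul_apply, hx]
    split_ifs <;> simp

lemma exists_decomp (n ℓ : ℕ) (hℓ : ℓ ≤ n) (x : H n) (hx : x ∈ Sp n) :
    ∃ g : Finset (Fin n) → H n,
      (∀ F : Finset (Fin n), F.card = ℓ → g F ∈ HparaM n (varpi n ℓ)) ∧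
      x = ∑ F ∈ colFinset n ℓ, Tw n (colPerm n F) * g F := by
  induction hx using Submodule.span_induction with
  | mem x h =>
    obtain ⟨w, rfl⟩ := h
    obtain ⟨F0, hF0⟩ : ∃ F0 : Finset (Fin n), F0 = (hwCol n ℓ).image w := ⟨_, rfl⟩
    have hcard : F0.card = ℓ := by
      rw [hF0, Finset.card_image_of_injective _ w.injective]
      unfold hwCol
      rw [Fin.card_filter_val_lt]; simp [hℓ]
    have hst : wAct n ((colPerm n F0)⁻¹ * w) (varpi n F0.card) = varpi n F0.card := by
      rw [stab_iff]
      intro y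
      rw [← (isU_colPerm n F0).1, Equiv.Perm.mul_apply, papp_inv, hcard, hF0]
      simp [hwCol]
    refine ⟨fun F => if F = F0 then Tw n ((colPerm n F0)⁻¹ * w) else 0, ?_, ?_⟩
    · intro F hF
      simp only
      split_ifs
      · exact Submodule.subset_span ⟨_, hcard ▸ hst, rfl⟩
      · exact zero_mem _
    · rw [Finset.sum_eq_single F0]
      · simp only [if_true]
        rw [← Tw_mul n F0 _ hst, mul_inv_cancel_left]
      · intro F _ hF; simp [hF]
      · intro h
        exact absurd (by simp [colFinset, hcard]) h
  | zero => exact ⟨0, by simp, by simp⟩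
  | add x y _ _ hx hy =>
    obtain ⟨g, g1, g2⟩ := hx
    obtain ⟨k, k1, k2⟩ := hy
    refine ⟨g + k, fun F hF => add_mem (g1 F hF) (k1 F hF), ?_⟩
    simp only [Pi.add_apply, mul_add, Finset.sum_add_distrib]
    rw [← g2, ← k2]
  | smul c x _ hx =>
    obtain ⟨g, g1, g2⟩ := hx
    refine ⟨c • g, fun F hF => Submodule.smul_mem _ _ (g1 F hF), ?_⟩
    simp only [Pi.smul_apply, mul_smul_comm]
    rw [← Finset.smul_sum, ← g2]

lemma paraCoeff_eq (n : ℕ) (x : H n) (hx : x ∈ Sp n) (F : Finset (Fin n)) :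
    paraCoeff n F.card x F = hcoef n x F := by
  have hex := exists_decomp n F.card (col_card_le n F) x hx
  unfold paraCoeff
  rw [dif_pos hex]
  obtain ⟨h1, h2⟩ := hex.choose_spec
  generalize hex.choose = g at h1 h2
  rw [Hpara_eq n _ (g F) (h1 F rfl)]
  unfold hcoef
  apply Finset.sum_congr rfl
  intro v hv
  rw [mem_stabFinset] at hv
  congr 1
  rw [h2, map_sum, Finset.sum_apply, Finset.sum_eq_single F]
  · rw [coeff_u_mul n F F rfl _ (h1 F rfl) v hv, if_pos rfl]
  · intro G hG hGF
    have hc : G.card = F.card := by simpa [colFinset] using hG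
    rw [coeff_u_mul n F G hc.symm _ (hc ▸ h1 G hc) v hv, if_neg hGF.symm]
  · intro h; exact absurd (by simp [colFinset]) h

end HLHecke

namespace HLHecke

/-! ### the elements `t^{ℓ(w)} (T_{w⁻¹})⁻¹` -/

lemma isUnit_Tg (n j : ℕ) : IsUnit (Tg n j) := by
  by_cases h : j + 1 < n
  · obtain ⟨h1, h2⟩ := T_Tinv (Tg n j) (Tg_quad n j h)
    exact ⟨⟨_, _, h1, h2⟩, rfl⟩
  · rw [Tg_junk n j h]; exact isUnit_one

lemma isUnit_Tw (n : ℕ) (w : Equiv.Perm (Fin n)) : IsUnit (Tw n w) := by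
  apply Tw_induction n (fun w => IsUnit (Tw n w))
  · simp only [Tw_one]; exact isUnit_one
  · intro j w hj ha h
    simp only [Tw_asc n j hj w ha]
    exact (isUnit_Tg n j).mul h

def tbar (n j : ℕ) : H n := tH n * Ring.inverse (Tg n j)

lemma tH_mul (n : ℕ) (x : H n) : tH n * x = tt • x := by
  unfold tH; rw [Algebra.smul_def]

lemma tbar_eq (n j : ℕ) (hj : j + 1 < n) : tbar n j = Tg n j + (1 - tt) • 1 := by
  unfold tbar
  rw [tH_mul]
  have h := (T_Tinv (Tg n j) (Tg_quad n j hj)).1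
  have : Ring.inverse (Tg n j) = tinv • (Tg n j + (1 - tt) • 1) := by
    rw [← mul_one (Ring.inverse _), Ring.inverse_mul_eq_iff_eq_mul _ _ _ (isUnit_Tg n j), h]
  rw [this, smul_smul, tt_tinv, one_smul]

lemma Tg_tbar (n j : ℕ) (x : H n) : Tg n j * (tbar n j * x) = tt • x := by
  unfold tbar
  rw [tH_mul, smul_mul_assoc, mul_smul_comm, Ring.mul_inverse_cancel_left _ _ (isUnit_Tg n j)]

def bar (n : ℕ) (w : Equiv.Perm (Fin n)) : H n :=
  tpow n (len n w) * Ring.inverse (Tw n w⁻¹)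

lemma bar_eq (n : ℕ) (w : Equiv.Perm (Fin n)) :
    bar n w = tt ^ inv n w • Ring.inverse (Tw n w⁻¹) := by
  unfold bar tpow
  rw [Algebra.smul_def, len_eq]

lemma bar_one (n : ℕ) : bar n 1 = 1 := by
  rw [bar_eq, inv_one, _root_.inv_one, Tw_one]; simp

lemma bar_asc (n j : ℕ) (hj : j + 1 < n) (w : Equiv.Perm (Fin n))
    (h : pos n w j < pos n w (j + 1)) : bar n (sgen n j * w) = tbar n j * bar n w := by
  have e : Tw n (sgen n j * w)⁻¹ = Tw n w⁻¹ * Tg n j := by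
    rw [mul_inv_rev, sgen_inv]
    apply Tw_asc_right n j hj
    rw [pos_eq n _ j (by omega), pos_eq n _ (j + 1) hj] at h
    exact h
  rw [bar_eq, bar_eq, e, inv_asc n j hj w h, Ring.inverse_mul (Or.inl (isUnit_Tw _ _)), tbar,
    tH_mul, smul_mul_smul_comm, pow_succ']

lemma bar_comm (n j k : ℕ) (hj : j + 1 < n) (hk : k + 1 < n) (u : Equiv.Perm (Fin n))
    (h : sgen n j * u = u * sgen n k) (h1 : u ⟨k, Nat.lt_of_succ_lt hk⟩ = ⟨j, Nat.lt_of_succ_lt hj⟩)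
    (h2 : u ⟨k + 1, hk⟩ = ⟨j + 1, hj⟩) : Tg n j * bar n u = bar n u * Tg n k := by
  have e1 : Tw n (u⁻¹ * sgen n j) = Tw n u⁻¹ * Tg n j := by
    apply Tw_asc_right n j hj
    rw [← h1, ← h2, pinv_app, pinv_app]
    simp
  have e2 : Tw n (sgen n k * u⁻¹) = Tg n k * Tw n u⁻¹ := by
    apply Tw_asc n k hk
    rw [pos_eq n _ k (by omega), pos_eq n _ (k + 1) hk, inv_inv, h1, h2]
    simp
  have e3 : u⁻¹ * sgen n j = sgen n k * u⁻¹ := by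
    rw [inv_mul_eq_iff_eq_mul, ← mul_assoc, ← h, mul_inv_cancel_right]
  rw [e3, e2] at e1
  rw [bar_eq, mul_smul_comm, smul_mul_assoc]
  congr 1
  have hu := isUnit_Tw n u⁻¹
  have : Ring.inverse (Tw n u⁻¹) * Tg n k = Tg n j * Ring.inverse (Tw n u⁻¹) := by
    rw [Ring.inverse_mul_eq_iff_eq_mul _ _ _ hu, ← mul_assoc, ← e1,
      Ring.mul_inverse_cancel_right _ _ hu]
  exact this.symm

lemma Sp_bar (n : ℕ) (w : Equiv.Perm (Fin n)) : ∀ x ∈ Sp n, bar n w * x ∈ Sp n := by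
  apply Tw_induction n (fun w => ∀ x ∈ Sp n, bar n w * x ∈ Sp n)
  · intro x hx; rwa [bar_one, one_mul]
  · intro j w hj ha ih x hx
    rw [bar_asc n j hj w ha, mul_assoc, tbar_eq n j hj, add_mul, smul_mul_assoc, one_mul]
    exact add_mem (Sp_Tg n j hj _ (ih x hx)) (Submodule.smul_mem _ _ (ih x hx))

/-! ### the core computation -/

lemma hcoef_add (n : ℕ) (x y : H n) (F : Finset (Fin n)) :
    hcoef n (x + y) F = hcoef n x F + hcoef n y F := by
  simp [hcoef, add_smul, Finset.sum_add_distrib]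

lemma hcoef_smul (n : ℕ) (c : HR) (x : H n) (F : Finset (Fin n)) :
    hcoef n (c • x) F = c • hcoef n x F := by
  simp [hcoef, mul_smul, Finset.smul_sum]

lemma colPerm_sCol' (n j : ℕ) (hj : j + 1 < n) (C : Finset (Fin n))
    (h1 : (⟨j, Nat.lt_of_succ_lt hj⟩ : Fin n) ∉ C) (h2 : (⟨j + 1, hj⟩ : Fin n) ∈ C) :
    colPerm n (sCol n j C) = sgen n j * colPerm n C := by
  have := colPerm_sCol n j hj (sCol n j C) (by rw [mem_sCol, sgen_left n j hj]; exact h2)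
    (by rw [mem_sCol, sgen_right n j hj]; exact h1)
  rw [sCol_sCol] at this
  rw [this, sgen_cancel]

lemma hcoef_A (n j : ℕ) (hj : j + 1 < n) (y : H n) (F : Finset (Fin n))
    (h1 : (⟨j, Nat.lt_of_succ_lt hj⟩ : Fin n) ∉ F) (h2 : (⟨j + 1, hj⟩ : Fin n) ∈ F) :
    hcoef n (Tg n j * y) F = hcoef n y (sCol n j F) + (tt - 1) • hcoef n y F := by
  unfold hcoef
  rw [card_sCol, Finset.smul_sum, ← Finset.sum_add_distrib]
  apply Finset.sum_congr rfl
  intro v hv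
  rw [mem_stabFinset] at hv
  rw [coeff_Tg_mul n j hj, if_neg, colPerm_sCol' n j hj F h1 h2, add_smul, mul_smul, mul_assoc]
  have a := pos_col n F v hv j (by omega)
  have b := pos_col n F v hv (j + 1) hj
  have a' := mt a.1 h1
  have b' := b.2 h2
  omega

lemma hcoef_B (n j : ℕ) (hj : j + 1 < n) (y : H n) (F : Finset (Fin n))
    (h1 : (⟨j, Nat.lt_of_succ_lt hj⟩ : Fin n) ∈ F) (h2 : (⟨j + 1, hj⟩ : Fin n) ∉ F) :
    hcoef n (Tg n j * y) F = tt • hcoef n y (sCol n j F) := by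
  unfold hcoef
  rw [card_sCol, Finset.smul_sum]
  apply Finset.sum_congr rfl
  intro v hv
  rw [mem_stabFinset] at hv
  rw [coeff_Tg_mul n j hj, if_pos, colPerm_sCol n j hj F h1 h2, mul_smul, mul_assoc]
  have a := pos_col n F v hv j (by omega)
  have b := pos_col n F v hv (j + 1) hj
  have a' := mt b.1 h2
  have b' := a.2 h1
  omega

lemma hcoef_C (n j k : ℕ) (hj : j + 1 < n) (hk : k + 1 < n) (y : H n) (F : Finset (Fin n))
    (h : sgen n j * colPerm n F = colPerm n F * sgen n k) (hb : k < F.card ↔ k + 1 < F.card)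
    (h1 : colPerm n F ⟨k, Nat.lt_of_succ_lt hk⟩ = ⟨j, Nat.lt_of_succ_lt hj⟩)
    (h2 : colPerm n F ⟨k + 1, hk⟩ = ⟨j + 1, hj⟩) :
    hcoef n (Tg n j * y) F = Tg n k * hcoef n y F := by
  rw [Hpara_eq n _ _ (Hpara_Tg n F.card k hk hb _ (hcoef_mem n y F))]
  conv_lhs => unfold hcoef
  apply Finset.sum_congr rfl
  intro v hv
  rw [mem_stabFinset] at hv
  congr 1
  rw [coeff_Tg_mul n j hj, coeff_Tg_mul n k hk, coeff_hcoef n y F v hv,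
    coeff_hcoef n y F _ (stab_mul n _ _ _ (stab_sgen n F.card k hk hb) hv), ← mul_assoc, h, mul_assoc]
  have p1 : pos n (colPerm n F * v) j = pos n v k := by
    rw [pos_eq n _ j (by omega), pos_eq n _ k (by omega), mul_inv_rev, Equiv.Perm.mul_apply,
      ← h1, pinv_app]
  have p2 : pos n (colPerm n F * v) (j + 1) = pos n v (k + 1) := by
    rw [pos_eq n _ (j + 1) hj, pos_eq n _ (k + 1) hk, mul_inv_rev, Equiv.Perm.mul_apply,
      ← h2, pinv_app]
  rw [p1, p2]

lemma bar_sCol (n j : ℕ) (hj : j + 1 < n) (C : Finset (Fin n))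
    (h1 : (⟨j, Nat.lt_of_succ_lt hj⟩ : Fin n) ∈ C) (h2 : (⟨j + 1, hj⟩ : Fin n) ∉ C) :
    bar n (colPerm n (sCol n j C)) = tbar n j * bar n (colPerm n C) := by
  rw [colPerm_sCol n j hj C h1 h2]
  apply bar_asc n j hj
  have a := pos_col n C 1 (by rw [stab_iff]; simp) j (by omega)
  have b := pos_col n C 1 (by rw [stab_iff]; simp) (j + 1) hj
  rw [mul_one] at a b
  have a' := mt b.1 h2
  have b' := a.2 h1
  omega

lemma bar_sCol' (n j : ℕ) (hj : j + 1 < n) (C : Finset (Fin n))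
    (h1 : (⟨j, Nat.lt_of_succ_lt hj⟩ : Fin n) ∉ C) (h2 : (⟨j + 1, hj⟩ : Fin n) ∈ C) :
    bar n (colPerm n C) = tbar n j * bar n (colPerm n (sCol n j C)) := by
  have := bar_sCol n j hj (sCol n j C) (by rw [mem_sCol, sgen_left n j hj]; exact h2)
    (by rw [mem_sCol, sgen_right n j hj]; exact h1)
  rwa [sCol_sCol] at this

lemma core (n j : ℕ) (hj : j + 1 < n) (x y : H n) (hxy : x = Tg n j * y + (1 - tt) • y)
    (F : Finset (Fin n)) :
    (((⟨j, Nat.lt_of_succ_lt hj⟩ : Fin n) ∈ F → (⟨j + 1, hj⟩ : Fin n) ∈ F) →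
      bar n (colPerm n F) * hcoef n x F =
        tbar n j * (bar n (colPerm n (sCol n j F)) * hcoef n y (sCol n j F))) ∧
    (((⟨j + 1, hj⟩ : Fin n) ∈ F → (⟨j, Nat.lt_of_succ_lt hj⟩ : Fin n) ∈ F) →
      bar n (colPerm n F) * hcoef n x F =
        Tg n j * (bar n (colPerm n (sCol n j F)) * hcoef n y (sCol n j F)) +
          (1 - tt) • (bar n (colPerm n F) * hcoef n y F)) := by
  have hx : hcoef n x F = hcoef n (Tg n j * y) F + (1 - tt) • hcoef n y F := by
    rw [hxy, hcoef_add, hcoef_smul]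
  by_cases hfix : (⟨j, Nat.lt_of_succ_lt hj⟩ : Fin n) ∈ F ↔ (⟨j + 1, hj⟩ : Fin n) ∈ F
  · obtain ⟨k, hk, e1, e2, e3, e4⟩ := colPerm_fix n j hj F hfix
    have hc := hcoef_C n j k hj hk y F e1 e2 e3 e4
    have hb := bar_comm n j k hj hk _ e1 e3 e4
    rw [sCol_fix n j hj F hfix, hx, hc, tbar_eq n j hj, mul_add, ← mul_assoc _ (Tg n k), ← hb,
      add_mul, mul_smul_comm, smul_mul_assoc, one_mul, mul_assoc]
    exact ⟨fun _ => rfl, fun _ => rfl⟩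
  · constructor
    · intro h
      have h1 : (⟨j, Nat.lt_of_succ_lt hj⟩ : Fin n) ∉ F := by tauto
      have h2 : (⟨j + 1, hj⟩ : Fin n) ∈ F := by tauto
      have : hcoef n x F = hcoef n y (sCol n j F) := by
        rw [hx, hcoef_A n j hj y F h1 h2]; module
      rw [this, bar_sCol' n j hj F h1 h2, mul_assoc]
    · intro h
      have h1 : (⟨j, Nat.lt_of_succ_lt hj⟩ : Fin n) ∈ F := by tauto
      have h2 : (⟨j + 1, hj⟩ : Fin n) ∉ F := by tauto
      rw [hx, hcoef_B n j hj y F h1 h2, bar_sCol n j hj F h1 h2, mul_assoc, Tg_tbar, mul_add,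
        mul_smul_comm, mul_smul_comm]

/-! ### highest weight tableaux -/

def stabL (n : ℕ) (L : List ℕ) : Finset (Equiv.Perm (Fin n)) :=
  Finset.univ.filter fun w => ∀ m ∈ L, wAct n w (varpi n m) = varpi n m

lemma mem_stabL (n : ℕ) (L : List ℕ) (w : Equiv.Perm (Fin n)) :
    w ∈ stabL n L ↔ ∀ m ∈ L, wAct n w (varpi n m) = varpi n m := by simp [stabL]

def oneP (n : ℕ) (L : List ℕ) : H n := ∑ w ∈ stabL n L, Tw n w

lemma oneP_mem (n : ℕ) (L : List ℕ) : oneP n L ∈ Sp n :=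
  Submodule.sum_mem _ fun w _ => Tw_mem_Sp n w

lemma coeff_oneP (n : ℕ) (L : List ℕ) (w : Equiv.Perm (Fin n)) :
    coeff n (oneP n L) w = if w ∈ stabL n L then 1 else 0 := by
  unfold oneP
  rw [map_sum, Finset.sum_apply]
  simp only [coeff_Tw]
  rw [Finset.sum_ite_eq]

lemma oneP_nil (n : ℕ) : oneP n [] = one0 n := by simp [oneP, one0, stabL]

lemma oneP_single (n a : ℕ) : oneP n [a] = onePara n (varpi n a) := by
  simp [oneP, onePara, stabL, stabFinset]

lemma Tg_oneP (n a k : ℕ) (hk : k + 1 < n) (h : k < a ↔ k + 1 < a) :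
    Tg n k * oneP n [a] = tt • oneP n [a] := by
  apply Sp_ext n _ _ (Sp_Tg n k hk _ (oneP_mem n _)) (Submodule.smul_mem _ _ (oneP_mem n _))
  intro w
  have e : sgen n k * w ∈ stabL n [a] ↔ w ∈ stabL n [a] := by
    simp only [mem_stabL, List.mem_singleton, forall_eq]
    exact stab_mul_left n a _ _ (stab_sgen n a k hk h)
  rw [coeff_Tg_mul n k hk, map_smul, Pi.smul_apply, coeff_oneP, coeff_oneP, if_congr e rfl rfl,
    smul_eq_mul]
  split_ifs <;> ring

lemma colPerm_pt (n m : ℕ) (E : Finset (Fin n)) (hE : hwCol n m ⊆ E) (i : ℕ) (hi : i < n)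
    (him : i < m) : colPerm n E ⟨i, hi⟩ = ⟨i, hi⟩ := by
  have hU := isU_colPerm n E
  induction i using Nat.strong_induction_on with
  | _ i ih =>
    obtain ⟨z, hz⟩ := (colPerm n E).surjective ⟨i, hi⟩
    have hzE : (z : ℕ) < E.card := by
      rw [← hU.1, hz]
      exact hE (by simp [hwCol, him])
    rcases lt_trichotomy (z : ℕ) i with h | h | h
    · have := ih z h z.isLt (by omega)
      change colPerm n E z = z at this
      rw [this] at hz
      rw [hz] at h
      simp at h
    · have : z = ⟨i, hi⟩ := Fin.ext h
      rw [← this, hz, this]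
    · have h1 := hU.2 ⟨i, hi⟩ z h (by simp only; omega)
      rw [hz, Fin.lt_def] at h1
      simp only at h1
      have h2 := ih _ h1 (by omega) (by omega)
      have h3 := (colPerm n E).injective h2
      rw [Fin.ext_iff] at h3
      simp only at h3
      omega

lemma colPerm_stab (n m : ℕ) (E : Finset (Fin n)) (hE : hwCol n m ⊆ E) :
    wAct n (colPerm n E) (varpi n m) = varpi n m := by
  rw [stab_iff]
  intro x
  constructor
  · intro h
    have h1 := colPerm_pt n m E hE _ (colPerm n E x).isLt h
    have h2 := (colPerm n E).injective h1
    rw [← h2]; exact h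
  · intro h
    have h1 := colPerm_pt n m E hE x x.isLt h
    change colPerm n E x = x at h1
    rw [h1]; exact h

lemma paraCoeff_oneP (n : ℕ) (L : List ℕ) (E : Finset (Fin n)) (hE : ∀ m ∈ L, hwCol n m ⊆ E) :
    paraCoeff n E.card (oneP n L) E = oneP n (E.card :: L) := by
  rw [paraCoeff_eq n _ (oneP_mem n L)]
  unfold hcoef
  have e : ∀ v, colPerm n E * v ∈ stabL n L ↔ v ∈ stabL n L := by
    intro v
    simp only [mem_stabL]
    exact forall₂_congr fun m hm => stab_mul_left n m _ _ (colPerm_stab n m E (hE m hm))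
  simp only [coeff_oneP, e, ite_smul, one_smul, zero_smul]
  rw [← Finset.sum_filter]
  unfold oneP
  apply Finset.sum_congr _ (fun _ _ => rfl)
  ext v
  simp [mem_stabL, mem_stabFinset]

lemma Psi_cons (n : ℕ) (C : Finset (Fin n)) (S : List (Finset (Fin n))) :
    Psi n (C :: S) = bar n (colPerm n C) * paraCoeff n C.card (Psi n S) C := by
  cases S with
  | nil =>
    simp only [Psi]
    rw [← oneP_nil, paraCoeff_oneP n [] C (by simp), oneP_single]
    rfl
  | cons D S => rw [Psi]; rfl; simp

lemma card_hwCol (n k : ℕ) (hk : k ≤ n) : (hwCol n k).card = k := by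
  unfold hwCol
  rw [Fin.card_filter_val_lt]; simp [hk]

lemma colPerm_hwCol (n k : ℕ) (hk : k ≤ n) : colPerm n (hwCol n k) = 1 := by
  apply isU_unique n (hwCol n k).card (hwCol n k) _ _ (isU_colPerm n _)
  rw [card_hwCol n k hk]
  constructor
  · intro x; simp [hwCol]
  · intro x y h _; exact h

lemma hwCol_mono (n m k : ℕ) (h : m ≤ k) : hwCol n m ⊆ hwCol n k := by
  intro x hx
  simp [hwCol] at *
  omega

lemma Psi_hw (n : ℕ) (L : List ℕ) (h1 : L.Pairwise (fun a b => b ≤ a)) (h2 : ∀ m ∈ L, m ≤ n) :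
    Psi n (L.map (hwCol n)) = oneP n L := by
  induction L with
  | nil => simp [Psi, oneP_nil]
  | cons k L ih =>
    rw [List.pairwise_cons] at h1
    have hk := h2 k (by simp)
    rw [List.map_cons, Psi_cons, ih h1.2 (fun m hm => h2 m (by simp [hm])),
      paraCoeff_oneP n L _ (fun m hm => hwCol_mono n m k (h1.1 m hm)), colPerm_hwCol n k hk,
      bar_one, one_mul, card_hwCol n k hk]

lemma Psi_E (n : ℕ) (L : List ℕ) (h1 : L.Pairwise (fun a b => b ≤ a)) (h2 : ∀ m ∈ L, m ≤ n)
    (E : Finset (Fin n)) (hE : ∀ m ∈ L, hwCol n m ⊆ E) :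
    Psi n (E :: L.map (hwCol n)) = bar n (colPerm n E) * oneP n (E.card :: L) := by
  rw [Psi_cons, Psi_hw n L h1 h2, paraCoeff_oneP n L E hE]

def shapeL (n : ℕ) (μ : Fin n → ℤ) : List ℕ :=
  List.ofFn fun j : Fin (numCols n μ) => shapeColLen n μ (j : ℕ)

lemma hwTableau_eq (n : ℕ) (μ : Fin n → ℤ) : hwTableau n μ = (shapeL n μ).map (hwCol n) := by
  unfold hwTableau shapeL
  rw [List.map_ofFn]
  rfl

lemma shapeColLen_anti (n : ℕ) (μ : Fin n → ℤ) (i j : ℕ) (h : i ≤ j) :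
    shapeColLen n μ j ≤ shapeColLen n μ i := by
  apply Finset.card_le_card
  intro x hx
  simp at *
  omega

lemma shapeL_pairwise (n : ℕ) (μ : Fin n → ℤ) :
    (shapeL n μ).Pairwise (fun a b => b ≤ a) := by
  unfold shapeL
  rw [List.pairwise_ofFn]
  intro i j hij
  exact shapeColLen_anti n μ i j hij.le

lemma shapeL_le (n : ℕ) (μ : Fin n → ℤ) : ∀ m ∈ shapeL n μ, m ≤ n := by
  intro m hm
  unfold shapeL at hm
  rw [List.mem_ofFn] at hm
  obtain ⟨i, rfl⟩ := hm
  exact col_card_le n _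

lemma nth_eq (n : ℕ) (C : Finset (Fin n)) (k : ℕ) (hk : k < C.card) :
    nth n C k = (colPerm n C ⟨k, lt_of_lt_of_le hk (col_card_le n C)⟩ : Fin n) := by
  rw [colPerm_lt n C _ hk, Finset.coe_orderIsoOfFin_apply, Finset.orderEmbOfFin_apply]
  unfold nth
  rw [List.getD_eq_getElem _ _ (by simpa using hk)]
  simp

lemma pairSS_sub (n k : ℕ) (hk : k ≤ n) (E : Finset (Fin n)) (hkE : k ≤ E.card)
    (h : pairSS n E (hwCol n k)) : hwCol n k ⊆ E := by
  have key : ∀ i (hi : i < k), colPerm n E ⟨i, by omega⟩ = ⟨i, by omega⟩ := by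
    intro i
    induction i using Nat.strong_induction_on with
    | _ i ih =>
      intro hi
      have h1 := h i (by rw [card_hwCol n k hk]; exact hi)
      rw [nth_eq n E i (by omega), nth_eq n _ i (by rw [card_hwCol n k hk]; exact hi),
        colPerm_hwCol n k hk] at h1
      simp only [Equiv.Perm.one_apply] at h1
      rcases h1.lt_or_eq with h2 | h2
      · have h3 := ih _ h2 (by omega)
        have h4 := (colPerm n E).injective h3
        rw [Fin.ext_iff] at h4
        simp only at h4
        omega
      · exact Fin.ext h2
  intro x hx
  have hx' : (x : ℕ) < k := by simpa [hwCol] using hx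
  have := key x hx'
  change colPerm n E x = x at this
  rw [← this, (isU_colPerm n E).1]
  omega

lemma SS_sub (n : ℕ) (μ : Fin n → ℤ) (E : Finset (Fin n)) (hE : shapeColLen n μ 0 ≤ E.card)
    (h : isSSYT n (E :: hwTableau n μ)) : ∀ m ∈ shapeL n μ, hwCol n m ⊆ E := by
  intro m hm
  rw [hwTableau_eq] at h
  have h1 := shapeL_pairwise n μ
  have h2 := shapeL_le n μ
  have h0 : ∀ m ∈ shapeL n μ, m ≤ shapeColLen n μ 0 := by
    intro m hm
    unfold shapeL at hm
    rw [List.mem_ofFn] at hm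
    obtain ⟨i, rfl⟩ := hm
    exact shapeColLen_anti n μ 0 i (Nat.zero_le _)
  cases hL : shapeL n μ with
  | nil => rw [hL] at hm; simp at hm
  | cons k L =>
    rw [hL] at h h1 h2 hm h0
    unfold isSSYT at h
    have hp : pairSS n E (hwCol n k) := by
      rw [List.map_cons] at h
      exact (List.isChain_cons_cons.1 h).1
    have := pairSS_sub n k (h2 k (by simp)) E (le_trans (h0 k (by simp)) hE) hp
    refine subset_trans (hwCol_mono n m k ?_) this
    rcases List.mem_cons.1 hm with rfl | hm
    · exact le_rfl
    · exact (List.pairwise_cons.1 h1).1 m hm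

/-! ### final assembly -/

lemma final (n j : ℕ) (hj : j + 1 < n) (S : List (Finset (Fin n))) (E F : Finset (Fin n))
    (hm : Psi n (sCol n j E :: S) ∈ Sp n)
    (hxy : Psi n (E :: S) = tbar n j * Psi n (sCol n j E :: S)) :
    ((((⟨j, Nat.lt_of_succ_lt hj⟩ : Fin n) ∈ F → (⟨j + 1, hj⟩ : Fin n) ∈ F) →
            Psi n (F :: E :: S)
              = tH n * Ring.inverse (Tg n j) *
                  Psi n (sCol n j F :: sCol n j E :: S))
          ∧ (((⟨j + 1, hj⟩ : Fin n) ∈ F → (⟨j, Nat.lt_of_succ_lt hj⟩ : Fin n) ∈ F) →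
            Psi n (F :: E :: S)
              = Tg n j * Psi n (sCol n j F :: sCol n j E :: S)
                  + (1 - tH n) * Psi n (F :: sCol n j E :: S))) := by
  have e : Psi n (E :: S) =
      Tg n j * Psi n (sCol n j E :: S) + (1 - tt) • Psi n (sCol n j E :: S) := by
    rw [hxy, tbar_eq n j hj, add_mul, smul_mul_assoc, one_mul]
  have hm' : Psi n (E :: S) ∈ Sp n := by
    rw [e]; exact add_mem (Sp_Tg n j hj _ hm) (Submodule.smul_mem _ _ hm)
  have hc := core n j hj _ _ e F
  have es : ∀ z : H n, (1 - tH n) * z = (1 - tt) • z := by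
    intro z
    refine (sub_mul (1 : H n) (tH n) z).trans ?_
    rw [one_mul, tH_mul]
    exact ((sub_smul (1 : HR) tt z).trans (by rw [one_smul])).symm
  rw [es, Psi_cons n F (E :: S), Psi_cons n (sCol n j F) (sCol n j E :: S),
    Psi_cons n F (sCol n j E :: S), paraCoeff_eq n _ hm', paraCoeff_eq n _ hm, paraCoeff_eq n _ hm]
  exact hc

lemma step_swap (n j : ℕ) (hj : j + 1 < n) (L : List ℕ) (h1 : L.Pairwise (fun a b => b ≤ a))
    (h2 : ∀ m ∈ L, m ≤ n) (E : Finset (Fin n)) (hE : ∀ m ∈ L, hwCol n m ⊆ E)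
    (he1 : (⟨j, Nat.lt_of_succ_lt hj⟩ : Fin n) ∉ E) (he2 : (⟨j + 1, hj⟩ : Fin n) ∈ E) :
    Psi n (sCol n j E :: L.map (hwCol n)) ∈ Sp n ∧
    Psi n (E :: L.map (hwCol n)) = tbar n j * Psi n (sCol n j E :: L.map (hwCol n)) := by
  have hE' : ∀ m ∈ L, hwCol n m ⊆ sCol n j E := by
    intro m hm x hx
    have hjm : m ≤ j := by
      by_contra h
      exact he1 (hE m hm (by simp [hwCol]; omega))
    have hxm : (x : ℕ) < m := by simpa [hwCol] using hx
    have : sgen n j x = x := by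
      ext; rw [sgen_val n j hj]
      split_ifs <;> omega
    rw [mem_sCol, this]
    exact hE m hm hx
  rw [Psi_E n L h1 h2 E hE, Psi_E n L h1 h2 _ hE', card_sCol]
  refine ⟨Sp_bar n _ _ (oneP_mem n _), ?_⟩
  rw [bar_sCol' n j hj E he1 he2, mul_assoc]

lemma step_fix (n j : ℕ) (hj : j + 1 < n) (E : Finset (Fin n))
    (h : (⟨j, Nat.lt_of_succ_lt hj⟩ : Fin n) ∈ E ↔ (⟨j + 1, hj⟩ : Fin n) ∈ E) :
    Psi n (sCol n j E :: []) ∈ Sp n ∧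
    Psi n (E :: []) = tbar n j * Psi n (sCol n j E :: []) := by
  have e := Psi_E n [] (by simp) (by simp) E (by simp)
  rw [List.map_nil] at e
  obtain ⟨k, hk, e1, e2, e3, e4⟩ := colPerm_fix n j hj E h
  rw [sCol_fix n j hj E h, e]
  refine ⟨Sp_bar n _ _ (oneP_mem n _), ?_⟩
  rw [tbar_eq n j hj, add_mul, ← mul_assoc, bar_comm n j k hj hk _ e1 e3 e4, mul_assoc,
    Tg_oneP n E.card k hk e2, smul_mul_assoc, one_mul, mul_smul_comm]
  module

end HLHecke

namespace HLHecke

/-- the two-column recursion for `Ψ`.  Part (1): with the highest weight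
tableau `T⁰_μ` attached, for `j ∉ E`, `j+1 ∈ E`.  Part (2): for two arbitrary columns with
`s_jE ≤ E`. -/
theorem stmt16 (n : ℕ) (hn : 1 ≤ n) (j : ℕ) (hj : j + 1 < n) :
    (∀ μ : Fin n → ℤ, Antitone μ → (∀ i, 0 ≤ μ i) →
      ∀ a b : ℕ, shapeColLen n μ 0 ≤ a → a ≤ b → b ≤ n →
      ∀ E F : Finset (Fin n), E.card = a → F.card = b →
        isSSYT n (E :: hwTableau n μ) →
        (⟨j, by omega⟩ : Fin n) ∉ E → (⟨j + 1, hj⟩ : Fin n) ∈ E →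
        ((((⟨j, by omega⟩ : Fin n) ∈ F → (⟨j + 1, hj⟩ : Fin n) ∈ F) →
            Psi n (F :: E :: hwTableau n μ)
              = tH n * Ring.inverse (Tg n j) *
                  Psi n (sCol n j F :: sCol n j E :: hwTableau n μ))
          ∧ (((⟨j + 1, hj⟩ : Fin n) ∈ F → (⟨j, by omega⟩ : Fin n) ∈ F) →
            Psi n (F :: E :: hwTableau n μ)
              = Tg n j * Psi n (sCol n j F :: sCol n j E :: hwTableau n μ)
                  + (1 - tH n) * Psi n (F :: sCol n j E :: hwTableau n μ))))
    ∧ (∀ a b : ℕ, 1 ≤ a → a ≤ b → b ≤ n →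
      ∀ E F : Finset (Fin n), E.card = a → F.card = b →
        ((⟨j, by omega⟩ : Fin n) ∈ E → (⟨j + 1, hj⟩ : Fin n) ∈ E) →
        ((((⟨j, by omega⟩ : Fin n) ∈ F → (⟨j + 1, hj⟩ : Fin n) ∈ F) →
            Psi n [F, E] = tH n * Ring.inverse (Tg n j) * Psi n [sCol n j F, sCol n j E])
          ∧ (((⟨j + 1, hj⟩ : Fin n) ∈ F → (⟨j, by omega⟩ : Fin n) ∈ F) →
            Psi n [F, E] = Tg n j * Psi n [sCol n j F, sCol n j E]
              + (1 - tH n) * Psi n [F, sCol n j E]))) := by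
  constructor
  · intro μ _ _ a b hμ hab hb E F hE hF hss he1 he2
    have hsub := SS_sub n μ E (by omega) hss
    obtain ⟨m, e⟩ := step_swap n j hj (shapeL n μ) (shapeL_pairwise n μ) (shapeL_le n μ) E hsub
      he1 he2
    rw [← hwTableau_eq] at m e
    exact final n j hj (hwTableau n μ) E F m e
  · intro a b _ _ _ E F _ _ hE
    by_cases h : (⟨j, by omega⟩ : Fin n) ∈ E ↔ (⟨j + 1, hj⟩ : Fin n) ∈ E
    · obtain ⟨m, e⟩ := step_fix n j hj E h
      exact final n j hj [] E F m e
    · have he1 : (⟨j, by omega⟩ : Fin n) ∉ E := by tauto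
      have he2 : (⟨j + 1, hj⟩ : Fin n) ∈ E := by tauto
      obtain ⟨m, e⟩ := step_swap n j hj [] (by simp) (by simp) E (by simp) he1 he2
      exact final n j hj [] E F m e

end HLHecke
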